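/- arXiv:2510.00965 — 4 statements merged into one kernel-verified Lean document; each statement's English description precedes it below -/
import Mathlib

section
/- For every integer d ≥ 2, the Ranking algorithm is at most γ(d)-competitive for online bipartite matching on d-regular graphs, where γ(d) = 1 − ((d−1)/(2d−1))·(1−1/d)^d. Concretely: there exists a d-regular bipartite graph G(S ∪ R, E) together with an arrival order of the requests R such that the expected size of the matching produced by Ranking is at most γ(d) times the size of a maximum matching of G. -/
open MeasureTheory

/-- The uniform probability measure on the cube `[0,1]^n`:
the product of Lebesgue measure restricted to `[0,1]`. -/
noncomputable def uniformCube (n : ℕ) : Measure (Fin n → ℝ) :=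
  Measure.pi fun _ => volume.restrict (Set.Icc (0 : ℝ) 1)

/-- One step of the Ranking algorithm: a request with neighborhood `N` is matched to
its currently unmatched neighbor of least rank (if any), which is then added to the
set `M` of matched servers. -/
noncomputable def rankingStep {n : ℕ} (y : Fin n → ℝ) (M N : Finset (Fin n)) : Finset (Fin n) :=
  match List.argmin y (N \ M).toList with
  | some s => insert s M
  | none => M

/-- The set of servers matched by the Ranking algorithm with server ranks `y`, when the
requests arrive in the order of the list `Ns` of their neighborhoods. -/
noncomputable def rankingMatched {n : ℕ} (y : Fin n → ℝ) (Ns : List (Finset (Fin n))) : Finset (Fin n) :=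
  Ns.foldl (rankingStep y) ∅


open scoped ENNReal

theorem List.argmin_congr_of_lt_iff {α β : Type*} [LinearOrder β] {f g : α → β} {l : List α}
    (h : ∀ i ∈ l, ∀ j ∈ l, (f i < f j ↔ g i < g j)) : l.argmin f = l.argmin g := by
  induction l using List.reverseRecOn with
  | nil => rfl
  | append_singleton l a ih =>
    have ih' := ih fun i hi j hj => h i (by simp [hi]) j (by simp [hj])
    rw [List.argmin_concat, List.argmin_concat, ih']
    cases hc : l.argmin g with
    | none => rfl
    | some c =>
      have hcl : c ∈ l := List.argmin_mem hc
      simp only [h a (by simp) c (by simp [hcl])]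

theorem Finset.argmin_toList_eq_some {α β : Type*} [LinearOrder β] {f : α → β} {s : Finset α}
    {x : α} (hx : x ∈ s) (hmin : ∀ i ∈ s, i ≠ x → f x < f i) :
    s.toList.argmin f = some x := by
  cases hc : s.toList.argmin f with
  | none => simp_all
  | some c =>
    have hcs : c ∈ s := Finset.mem_toList.1 (List.argmin_mem hc)
    by_contra hne
    exact absurd (List.le_of_mem_argmin (Finset.mem_toList.2 hx) hc)
      (not_le.2 (hmin c hcs fun h => hne (by rw [h])))

/-- The servers of `B` left unmatched by Ranking when the requests have the neighborhoods
`insert a B`, for `a` running through a list of distinct servers outside `B`. -/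
noncomputable def survivors {n : ℕ} (y : Fin n → ℝ) :
    List (Fin n) → Finset (Fin n) → Finset (Fin n)
  | [], B => B
  | a :: L, B =>
    match List.argmin y (insert a B).toList with
    | some s => survivors y L (B.erase s)
    | none => B

section Survivors

variable {n : ℕ} {y : Fin n → ℝ}

theorem sdiff_foldl_rankingStep (B : Finset (Fin n)) (L : List (Fin n)) (hL : L.Nodup)
    (hLB : ∀ a ∈ L, a ∉ B) (M : Finset (Fin n)) (hLM : ∀ a ∈ L, a ∉ M) :
    B \ (L.map (insert · B)).foldl (rankingStep y) M = survivors y L (B \ M) := by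
  induction L generalizing M with
  | nil => rfl
  | cons a L ih =>
    rw [List.nodup_cons] at hL
    have hset : insert a B \ M = insert a (B \ M) :=
      Finset.insert_sdiff_of_notMem _ (hLM a (by simp))
    rw [List.map_cons, List.foldl_cons, survivors, rankingStep, hset]
    cases hs : List.argmin y (insert a (B \ M)).toList with
    | none => simp at hs
    | some s =>
      have hmem : s ∈ insert a (B \ M) := Finset.mem_toList.1 (List.argmin_mem hs)
      have hsM : B \ insert s M = (B \ M).erase s := by
        ext i; simp only [Finset.mem_sdiff, Finset.mem_insert, Finset.mem_erase]; tauto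
      simp only
      rw [ih hL.2 (fun b hb => hLB b (by simp [hb])), hsM]
      intro b hb hbM
      rcases Finset.mem_insert.1 hbM with rfl | hbM
      · rcases Finset.mem_insert.1 hmem with rfl | h
        · exact hL.1 hb
        · exact hLB b (by simp [hb]) (Finset.mem_sdiff.1 h).1
      · exact hLM b (by simp [hb]) hbM

theorem survivors_erase {x : Fin n} {L : List (Fin n)} (hx : x ∈ L) {B : Finset (Fin n)}
    (hmin : ∀ i ∈ B, y x < y i) : survivors y L B = survivors y (L.erase x) B := by
  induction L generalizing B with
  | nil => simp at hx
  | cons a L ih =>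
    by_cases hax : a = x
    · subst hax
      have hB : a ∉ B := fun h => lt_irrefl _ (hmin a h)
      rw [List.erase_cons_head, survivors, Finset.argmin_toList_eq_some (x := a) (by simp)]
      · simp [hB]
      · intro i hi hne
        exact hmin i (Finset.mem_of_mem_insert_of_ne hi hne)
    · rw [List.erase_cons_tail (by simpa using hax), survivors, survivors]
      cases hs : List.argmin y (insert a B).toList with
      | none => simp at hs
      | some s =>
        exact ih (by simpa [Ne.symm hax] using hx) fun i hi => hmin i (Finset.mem_of_mem_erase hi)

theorem survivors_cons_of_mem {b a : Fin n} {L : List (Fin n)} {B : Finset (Fin n)} (hb : b ∈ B)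
    (hmin : ∀ i ∈ insert a B, i ≠ b → y b < y i) :
    survivors y (a :: L) B = survivors y L (B.erase b) := by
  rw [survivors, Finset.argmin_toList_eq_some (Finset.mem_insert_of_mem hb) hmin]

theorem survivors_congr {y' : Fin n → ℝ} {L : List (Fin n)} {B X : Finset (Fin n)}
    (hL : ∀ a ∈ L, a ∈ X) (hB : B ⊆ X)
    (h : ∀ i ∈ X, ∀ j ∈ X, (y i < y j ↔ y' i < y' j)) : survivors y L B = survivors y' L B := by
  induction L generalizing B with
  | nil => rfl
  | cons a L ih =>
    have hsub : insert a B ⊆ X := Finset.insert_subset (hL a (by simp)) hB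
    have hs : (insert a B).toList.argmin y = (insert a B).toList.argmin y' :=
      List.argmin_congr_of_lt_iff fun i hi j hj =>
        h i (hsub (Finset.mem_toList.1 hi)) j (hsub (Finset.mem_toList.1 hj))
    rw [survivors, survivors, hs]
    cases (insert a B).toList.argmin y' with
    | none => rfl
    | some s =>
      exact ih (fun b hb => hL b (by simp [hb])) ((Finset.erase_subset _ _).trans hB)

theorem survivors_update {L : List (Fin n)} {B : Finset (Fin n)} {x : Fin n}
    (hL : x ∉ L) (hB : x ∉ B) (t : ℝ) :
    survivors (Function.update y x t) L B = survivors y L B := by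
  refine survivors_congr (X := Finset.univ.erase x) (fun a ha => ?_) (fun b hb => ?_) ?_
  · exact Finset.mem_erase.2 ⟨ne_of_mem_of_not_mem ha hL, Finset.mem_univ a⟩
  · exact Finset.mem_erase.2 ⟨ne_of_mem_of_not_mem hb hB, Finset.mem_univ b⟩
  · intro i hi j hj
    rw [Function.update_of_ne (Finset.ne_of_mem_erase hi),
      Function.update_of_ne (Finset.ne_of_mem_erase hj)]

end Survivors

theorem measurable_of_lt_iff_lt {n : ℕ} {α : Type*} [MeasurableSpace α] (F : (Fin n → ℝ) → α)
    (hF : ∀ y y' : Fin n → ℝ, (∀ i j, y i < y j ↔ y' i < y' j) → F y = F y') : Measurable F := by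
  let c : (Fin n → ℝ) → Fin n → Fin n → Prop := fun y i j => y i < y j
  have hc : Measurable c := by
    refine measurable_pi_lambda _ fun i => measurable_pi_lambda _ fun j => ?_
    exact measurableSet_setOfPred.1
      (measurableSet_lt (measurable_pi_apply i) (measurable_pi_apply j))
  let g : (Fin n → Fin n → Prop) → α := fun p => F (Function.invFun c p)
  have hg : F = g ∘ c := by
    funext y
    refine hF _ _ fun i j => ?_
    have := Function.invFun_eq (f := c) ⟨y, rfl⟩
    have h2 := congrFun (congrFun this i) j
    exact (iff_of_eq h2).symm
  rw [hg]
  exact (measurable_of_finite g).comp hc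

theorem measurable_card_survivors {n : ℕ} (L : List (Fin n)) (B : Finset (Fin n)) :
    Measurable fun y : Fin n → ℝ => (survivors y L B).card :=
  measurable_of_lt_iff_lt _ fun y y' h => by
    rw [survivors_congr (X := Finset.univ) (by simp) (by simp) fun i _ j _ => h i j]

instance : IsProbabilityMeasure (volume.restrict (Set.Icc (0 : ℝ) 1)) := ⟨by simp⟩

instance (n : ℕ) : IsProbabilityMeasure (uniformCube n) := by
  unfold uniformCube; infer_instance

theorem lintegral_uniformCube_update {n : ℕ} (x : Fin n) {G : (Fin n → ℝ) → ℝ≥0∞}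
    (hG : Measurable G) :
    ∫⁻ y, G y ∂uniformCube n =
      ∫⁻ t in Set.Icc (0 : ℝ) 1, ∫⁻ y, G (Function.update y x t) ∂uniformCube n := by
  have hupd : Measurable fun p : (Fin n → ℝ) × ℝ => G (Function.update p.1 x p.2) :=
    hG.comp measurable_update'
  rw [lintegral_lintegral_swap (f := fun t y => G (Function.update y x t))
    (hupd.comp measurable_swap).aemeasurable]
  refine lintegral_eq_of_lmarginal_eq {x} hG hupd.lintegral_prod_right ?_
  funext y
  simp [lmarginal_singleton]

theorem lintegral_one_sub_pow_mul {z c : ℝ} (hz : z ∈ Set.Icc (0 : ℝ) 1) (hc : 0 ≤ c) (k : ℕ) :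
    ∫⁻ t in Set.Icc (0 : ℝ) 1, (Set.Ioi z).indicator (fun t => ENNReal.ofReal ((1 - t) ^ k * c)) t =
      ENNReal.ofReal ((1 - z) ^ (k + 1) * (c / (k + 1))) := by
  rw [lintegral_indicator measurableSet_Ioi, Measure.restrict_restrict measurableSet_Ioi]
  have hset : Set.Ioi z ∩ Set.Icc 0 1 = Set.Ioc z 1 := by
    ext t; simp only [Set.mem_inter_iff, Set.mem_Ioi, Set.mem_Icc, Set.mem_Ioc]
    exact ⟨fun h => ⟨h.1, h.2.2⟩, fun h => ⟨h.1, hz.1.trans h.1.le, h.2⟩⟩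
  rw [hset, ← ofReal_integral_eq_lintegral_ofReal]
  · rw [← intervalIntegral.integral_of_le hz.2, intervalIntegral.integral_mul_const,
      intervalIntegral.integral_comp_sub_left (fun t => t ^ k) 1, integral_pow]
    congr 1
    simp
    ring
  · exact ((by fun_prop : Continuous fun t : ℝ => (1 - t) ^ k * c).integrableOn_Icc (a := z)
      (b := 1)).mono_set Set.Ioc_subset_Icc_self
  · refine (ae_restrict_iff' measurableSet_Ioc).2 (.of_forall fun t ht => ?_)
    have : 0 ≤ 1 - t := sub_nonneg.2 ht.2
    positivity

theorem measurableSet_forall_lt {n : ℕ} (X : Finset (Fin n)) (z : ℝ) :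
    MeasurableSet {y : Fin n → ℝ | ∀ i ∈ X, z < y i} := by
  simp only [Set.ofPred_forall]
  exact X.measurableSet_biInter fun i _ => measurableSet_lt measurable_const (measurable_pi_apply i)

theorem measurableSet_forall_erase_lt {n : ℕ} (X : Finset (Fin n)) (x : Fin n) (z : ℝ) :
    MeasurableSet {y : Fin n → ℝ | z < y x ∧ ∀ i ∈ X.erase x, y x < y i} := by
  refine (measurableSet_lt measurable_const (measurable_pi_apply x)).inter ?_
  change MeasurableSet {y : Fin n → ℝ | ∀ i ∈ X.erase x, y x < y i}
  simp only [Set.ofPred_forall]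
  exact (X.erase x).measurableSet_biInter fun i _ =>
    measurableSet_lt (measurable_pi_apply x) (measurable_pi_apply i)

theorem uniformCube_forall_lt {n : ℕ} (X : Finset (Fin n)) {z : ℝ} (hz : z ∈ Set.Icc (0 : ℝ) 1) :
    uniformCube n {y | ∀ i ∈ X, z < y i} = ENNReal.ofReal ((1 - z) ^ X.card) := by
  have hset : {y : Fin n → ℝ | ∀ i ∈ X, z < y i} =
      Set.univ.pi fun i => if i ∈ X then Set.Ioi z else Set.univ := by
    ext y
    simp only [Set.mem_ofPred_eq, Set.mem_pi, Set.mem_univ, true_implies]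
    refine forall_congr' fun i => ?_
    split_ifs with h <;> simp [h]
  have hone : volume.restrict (Set.Icc (0 : ℝ) 1) (Set.Ioi z) = ENNReal.ofReal (1 - z) := by
    have hIoc : Set.Ioi z ∩ Set.Icc 0 1 = Set.Ioc z 1 := by
      ext t; simp only [Set.mem_inter_iff, Set.mem_Ioi, Set.mem_Icc, Set.mem_Ioc]
      exact ⟨fun h => ⟨h.1, h.2.2⟩, fun h => ⟨h.1, hz.1.trans h.1.le, h.2⟩⟩
    rw [Measure.restrict_apply measurableSet_Ioi, hIoc, Real.volume_Ioc]
  rw [hset, uniformCube, Measure.pi_pi, ENNReal.ofReal_pow (sub_nonneg.2 hz.2), ← hone]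
  simp_rw [apply_ite (volume.restrict (Set.Icc (0 : ℝ) 1)), measure_univ]
  rw [Finset.prod_ite_mem, Finset.univ_inter, Finset.prod_const]

theorem ofReal_le_lintegral_indicator_min {n : ℕ} {F : (Fin n → ℝ) → ℝ≥0∞} (hF : Measurable F)
    {x : Fin n} (hFx : ∀ y t, F (Function.update y x t) = F y) {X : Finset (Fin n)} {c : ℝ}
    (hc : 0 ≤ c) {k : ℕ}
    (h : ∀ t ∈ Set.Icc (0 : ℝ) 1, ENNReal.ofReal ((1 - t) ^ k * c) ≤
      ∫⁻ y, {y : Fin n → ℝ | ∀ i ∈ X.erase x, t < y i}.indicator F y ∂uniformCube n)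
    {z : ℝ} (hz : z ∈ Set.Icc (0 : ℝ) 1) :
    ENNReal.ofReal ((1 - z) ^ (k + 1) * (c / (k + 1))) ≤
      ∫⁻ y, {y : Fin n → ℝ | z < y x ∧ ∀ i ∈ X.erase x, y x < y i}.indicator F y
        ∂uniformCube n := by
  rw [← lintegral_one_sub_pow_mul hz hc, lintegral_uniformCube_update x
    (hF.indicator (measurableSet_forall_erase_lt X x z))]
  refine setLIntegral_mono' measurableSet_Icc fun t ht => ?_
  by_cases hzt : z < t
  · rw [Set.indicator_of_mem (Set.mem_Ioi.2 hzt)]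
    refine (h t ht).trans (le_of_eq (lintegral_congr fun y => ?_))
    have hiff : (Function.update y x t ∈
        {y : Fin n → ℝ | z < y x ∧ ∀ i ∈ X.erase x, y x < y i}) ↔
        y ∈ {y : Fin n → ℝ | ∀ i ∈ X.erase x, t < y i} := by
      simp only [Set.mem_ofPred_eq, Function.update_self, hzt, true_and]
      refine forall₂_congr fun i hi => ?_
      rw [Function.update_of_ne (Finset.ne_of_mem_erase hi)]
    by_cases hy : y ∈ {y : Fin n → ℝ | ∀ i ∈ X.erase x, t < y i}
    · rw [Set.indicator_of_mem hy, Set.indicator_of_mem (hiff.2 hy), hFx]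
    · rw [Set.indicator_of_notMem hy, Set.indicator_of_notMem (mt hiff.1 hy)]
  · rw [Set.indicator_of_notMem (by simpa using hzt)]
    exact zero_le

/-- A lower bound for the expected number of survivors among `b` servers after `f` requests. -/
noncomputable def survivorBound (b f : ℕ) : ℝ := b * ((b : ℝ) / (b + 1)) ^ f

theorem survivorBound_nonneg (b f : ℕ) : 0 ≤ survivorBound b f := by
  unfold survivorBound; positivity

theorem survivorBound_succ_le (b f : ℕ) :
    (f + 1 + b) * survivorBound b (f + 1) ≤
      (f + 1) * survivorBound b f + b * survivorBound (b - 1) f := by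
  cases b with
  | zero => simp [survivorBound]
  | succ b =>
    simp only [survivorBound, Nat.add_sub_cancel]
    push_cast
    set β : ℝ := (b : ℝ) with hβ
    have hβ0 : 0 ≤ β := Nat.cast_nonneg b
    set x : ℝ := (β + 1) / (β + 1 + 1) with hx
    have hx0 : 0 < x := by positivity
    have hyx : β / (β + 1) = (1 - 1 / (β + 1) ^ 2) * x := by
      rw [hx]; field_simp; ring
    have hbern : 1 - f / (β + 1) ^ 2 ≤ (1 - 1 / (β + 1) ^ 2) ^ f := by
      have h1 : 1 / (β + 1) ^ 2 ≤ 1 := by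
        rw [div_le_one (by positivity)]; nlinarith
      have := one_add_mul_le_pow (a := -(1 / (β + 1) ^ 2)) (by linarith) f
      calc _ = 1 + (f : ℝ) * -(1 / (β + 1) ^ 2) := by ring
        _ ≤ _ := this
        _ = _ := by ring
    have hkey : (f + 1 + (β + 1)) * x ≤ (f + 1) + β * (1 - f / (β + 1) ^ 2) := by
      have : (f + 1) + β * (1 - f / (β + 1) ^ 2) - (f + 1 + (β + 1)) * x =
          f / ((β + 1) ^ 2 * (β + 1 + 1)) := by
        rw [hx]; field_simp; ring
      have h2 : 0 ≤ f / ((β + 1) ^ 2 * (β + 1 + 1)) := by positivity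
      linarith
    have hkey' : (f + 1 + (β + 1)) * x ≤ (f + 1) + β * (1 - 1 / (β + 1) ^ 2) ^ f :=
      hkey.trans (by gcongr)
    rw [hyx, mul_pow]
    calc _ = (β + 1) * x ^ f * ((f + 1 + (β + 1)) * x) := by ring
      _ ≤ (β + 1) * x ^ f * ((f + 1) + β * (1 - 1 / (β + 1) ^ 2) ^ f) := by gcongr
      _ = _ := by ring

theorem survivors_eq_of_min {n : ℕ} {y : Fin n → ℝ} {x a : Fin n} {L : List (Fin n)}
    {B X : Finset (Fin n)} (hLX : ∀ a' ∈ a :: L, a' ∈ X) (hBX : B ⊆ X)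
    (hmin : ∀ i ∈ X.erase x, y x < y i) :
    survivors y (a :: L) B =
      if x ∈ B then survivors y L (B.erase x) else survivors y ((a :: L).erase x) B := by
  split_ifs with hxB
  · refine survivors_cons_of_mem hxB fun i hi hne => hmin i (Finset.mem_erase.2 ⟨hne, ?_⟩)
    exact Finset.insert_subset (hLX a (by simp)) hBX hi
  · by_cases hxL : x ∈ a :: L
    · exact survivors_erase hxL fun i hi =>
        hmin i (Finset.mem_erase.2 ⟨ne_of_mem_of_not_mem hi hxB, hBX hi⟩)
    · rw [List.erase_of_not_mem hxL]

theorem sum_ite_mem_ite_mem_list {α : Type*} [DecidableEq α] {X B : Finset α} {L : List α}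
    (hL : L.Nodup) (hLX : ∀ a ∈ L, a ∈ X) (hBX : B ⊆ X) (hLB : ∀ a ∈ L, a ∉ B) (p q r : ℝ) :
    ∑ x ∈ X, (if x ∈ B then p else if x ∈ L then q else r) =
      B.card * p + L.length * q + (X.card - B.card - L.length) * r := by
  have hterm : ∀ x, (if x ∈ B then p else if x ∈ L then q else r) =
      (if x ∈ B then p - r else 0) + (if x ∈ L.toFinset then q - r else 0) + r := by
    intro x
    by_cases hB : x ∈ B
    · have : x ∉ L := fun h => hLB x h hB
      simp [hB, this]
    · by_cases h : x ∈ L <;> simp [hB, h]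
  have hLX' : L.toFinset ⊆ X := fun a ha => hLX a (by simpa using ha)
  simp only [hterm, Finset.sum_add_distrib, Finset.sum_ite_mem, Finset.inter_eq_right.2 hBX,
    Finset.inter_eq_right.2 hLX', Finset.sum_const, List.toFinset_card_of_nodup hL, nsmul_eq_mul]
  ring

theorem survivorBound_le_lintegral_card_survivors {n : ℕ} (X : Finset (Fin n)) :
    ∀ (L : List (Fin n)) (B : Finset (Fin n)), L.Nodup → (∀ a ∈ L, a ∈ X) → B ⊆ X →
      (∀ a ∈ L, a ∉ B) → ∀ z ∈ Set.Icc (0 : ℝ) 1,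
      ENNReal.ofReal ((1 - z) ^ X.card * survivorBound B.card L.length) ≤
        ∫⁻ y, {y : Fin n → ℝ | ∀ i ∈ X, z < y i}.indicator
          (fun y => ((survivors y L B).card : ℝ≥0∞)) y ∂uniformCube n := by
  induction hk : X.card generalizing X with
  | zero =>
    intro L B _ _ hBX _ z _
    have : B = ∅ := Finset.subset_empty.1 (Finset.card_eq_zero.1 hk ▸ hBX)
    simp [this, survivorBound]
  | succ k ih =>
    intro L B hL hLX hBX hLB z hz
    cases L with
    | nil =>
      simp only [survivors]
      rw [lintegral_indicator_const (measurableSet_forall_lt X z), uniformCube_forall_lt X hz, hk,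
        survivorBound, List.length_nil, pow_zero, mul_one,
        ENNReal.ofReal_mul (pow_nonneg (sub_nonneg.2 hz.2) _), ENNReal.ofReal_natCast, mul_comm]
    | cons a L =>
      let U : Fin n → (Fin n → ℝ) → ℝ≥0∞ := fun x y =>
        ((if x ∈ B then survivors y L (B.erase x) else survivors y ((a :: L).erase x) B).card : ℝ≥0∞)
      let S : Fin n → Set (Fin n → ℝ) := fun x =>
        {y : Fin n → ℝ | z < y x ∧ ∀ i ∈ X.erase x, y x < y i}
      let φ : Fin n → ℝ := fun x =>
        if x ∈ B then survivorBound (B.card - 1) L.length else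
          if x ∈ a :: L then survivorBound B.card L.length
          else survivorBound B.card (L.length + 1)
      have hφ : ∀ x, 0 ≤ φ x := fun x => by
        simp only [φ]; split_ifs <;> exact survivorBound_nonneg _ _
      have hU : ∀ x, Measurable (U x) := fun x => by
        simp only [U]
        split_ifs
        · exact measurable_from_top.comp (measurable_card_survivors _ _)
        · exact measurable_from_top.comp (measurable_card_survivors _ _)
      have hterm : ∀ x ∈ X, ENNReal.ofReal ((1 - z) ^ (k + 1) * (φ x / (k + 1))) ≤
          ∫⁻ y, (S x).indicator (U x) y ∂uniformCube n := by
        intro x hx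
        have hcard : (X.erase x).card = k := by rw [Finset.card_erase_of_mem hx, hk]; rfl
        refine ofReal_le_lintegral_indicator_min (hU x) (fun y t => ?_) (hφ x) (fun t ht => ?_) hz
        · simp only [U]
          split_ifs with hxB
          · rw [survivors_update (fun h => hLB x (by simp [h]) hxB) (by simp)]
          · rw [survivors_update (by simpa using hL.not_mem_erase) hxB]
        · simp only [U, φ]
          split_ifs with hxB hxL
          · rw [← Finset.card_erase_of_mem hxB]
            refine ih _ hcard L _ hL.of_cons (fun b hb => ?_) (Finset.erase_subset_erase _ hBX)
              (fun b hb h => hLB b (by simp [hb]) (Finset.mem_of_mem_erase h)) t ht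
            refine Finset.mem_erase.2 ⟨?_, hLX b (by simp [hb])⟩
            rintro rfl
            exact hLB b (by simp [hb]) hxB
          · have hlen : ((a :: L).erase x).length = L.length := by
              rw [List.length_erase_of_mem hxL]; rfl
            rw [← hlen]
            refine ih _ hcard _ _ (hL.erase x) (fun b hb => ?_) (Finset.subset_erase.2 ⟨hBX, hxB⟩)
              (fun b hb => hLB b (List.mem_of_mem_erase hb)) t ht
            exact Finset.mem_erase.2 ⟨(hL.mem_erase_iff.1 hb).1, hLX b (List.mem_of_mem_erase hb)⟩
          · rw [List.erase_of_not_mem hxL]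
            refine ih _ hcard _ _ hL (fun b hb => ?_) (Finset.subset_erase.2 ⟨hBX, hxB⟩) hLB t ht
            exact Finset.mem_erase.2 ⟨ne_of_mem_of_not_mem hb hxL, hLX b hb⟩
      have hsum : (1 - z) ^ (k + 1) * survivorBound B.card (a :: L).length ≤
          ∑ x ∈ X, (1 - z) ^ (k + 1) * (φ x / (k + 1)) := by
        have hz' : 0 ≤ 1 - z := sub_nonneg.2 hz.2
        rw [← Finset.mul_sum, ← Finset.sum_div, sum_ite_mem_ite_mem_list hL hLX hBX hLB, hk,
          List.length_cons]
        refine mul_le_mul_of_nonneg_left ?_ (by positivity)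
        rw [le_div_iff₀ (by positivity)]
        have := survivorBound_succ_le B.card L.length
        push_cast
        linarith
      have hpoint : ∀ y, ∑ x ∈ X, (S x).indicator (U x) y ≤
          {y : Fin n → ℝ | ∀ i ∈ X, z < y i}.indicator
            (fun y => ((survivors y (a :: L) B).card : ℝ≥0∞)) y := by
        intro y
        by_cases hy : ∃ x ∈ X, y ∈ S x
        · obtain ⟨x, hx, hxS⟩ := hy
          rw [Finset.sum_eq_single_of_mem x hx, Set.indicator_of_mem hxS, Set.indicator_of_mem]
          · simp only [U, survivors_eq_of_min hLX hBX hxS.2, le_refl]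
          · intro i hi
            by_cases hix : i = x
            · exact hix ▸ hxS.1
            · exact hxS.1.trans (hxS.2 i (Finset.mem_erase.2 ⟨hix, hi⟩))
          · intro x' hx' hne
            refine Set.indicator_of_notMem (fun h => ?_) _
            exact lt_asymm (hxS.2 x' (Finset.mem_erase.2 ⟨hne, hx'⟩))
              (h.2 x (Finset.mem_erase.2 ⟨hne.symm, hx⟩))
        · push Not at hy
          rw [Finset.sum_eq_zero fun x hx => Set.indicator_of_notMem (hy x hx) _]
          exact zero_le
      calc _ ≤ ENNReal.ofReal (∑ x ∈ X, (1 - z) ^ (k + 1) * (φ x / (k + 1))) :=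
            ENNReal.ofReal_le_ofReal hsum
        _ = ∑ x ∈ X, ENNReal.ofReal ((1 - z) ^ (k + 1) * (φ x / (k + 1))) :=
            ENNReal.ofReal_sum_of_nonneg fun x _ =>
              mul_nonneg (pow_nonneg (sub_nonneg.2 hz.2) _) (div_nonneg (hφ x) (by positivity))
        _ ≤ ∑ x ∈ X, ∫⁻ y, (S x).indicator (U x) y ∂uniformCube n := Finset.sum_le_sum hterm
        _ = ∫⁻ y, ∑ x ∈ X, (S x).indicator (U x) y ∂uniformCube n :=
            (lintegral_finsetSum _ fun x _ =>
              (hU x).indicator (measurableSet_forall_erase_lt X x z)).symm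
        _ ≤ _ := lintegral_mono hpoint

theorem survivorBound_le_integral_card_survivors {n : ℕ} (L : List (Fin n)) (B : Finset (Fin n))
    (hL : L.Nodup) (hLB : ∀ a ∈ L, a ∉ B) :
    survivorBound B.card L.length ≤ ∫ y, ((survivors y L B).card : ℝ) ∂uniformCube n := by
  rw [integral_eq_lintegral_of_nonneg_ae (.of_forall fun y => Nat.cast_nonneg _)
    (measurable_from_top.comp (measurable_card_survivors L B)).aestronglyMeasurable]
  have hle := survivorBound_le_lintegral_card_survivors Finset.univ L B hL (by simp)
    (Finset.subset_univ B) hLB 0 (by simp)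
  simp only [sub_zero, one_pow, one_mul] at hle
  have hle' : ENNReal.ofReal (survivorBound B.card L.length) ≤
      ∫⁻ y, ENNReal.ofReal ((survivors y L B).card : ℝ) ∂uniformCube n := by
    simp only [ENNReal.ofReal_natCast]
    exact hle.trans (lintegral_mono fun y => Set.indicator_le_self _ _ _)
  refine (ENNReal.ofReal_le_iff_le_toReal (ne_of_lt ?_)).1 hle'
  refine (lintegral_mono (g := fun _ => (n : ℝ≥0∞)) fun y => ?_).trans_lt (by simp)
  simp only [ENNReal.ofReal_natCast]
  exact_mod_cast card_finset_fin_le _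

theorem integral_card_rankingMatched_le {n : ℕ} (L : List (Fin n)) (B A : Finset (Fin n))
    (hL : L.Nodup) (hLB : ∀ a ∈ L, a ∉ B) (hAB : Disjoint A B) (m : ℕ) :
    ∫ y, ((rankingMatched y (L.map (insert · B) ++ List.replicate m A)).card : ℝ) ∂uniformCube n ≤
      n - survivorBound B.card L.length := by
  have hmeas : Measurable fun y : Fin n → ℝ => ((survivors y L B).card : ℝ) :=
    measurable_from_top.comp (measurable_card_survivors L B)
  have hint : Integrable (fun y : Fin n → ℝ => ((survivors y L B).card : ℝ)) (uniformCube n) :=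
    Integrable.of_bound hmeas.aestronglyMeasurable (n : ℝ) (.of_forall fun y => by
      simpa using card_finset_fin_le (survivors y L B))
  have hstep : ∀ (y : Fin n → ℝ) (M : Finset (Fin n)),
      B \ (List.replicate m A).foldl (rankingStep y) M = B \ M := by
    intro y
    induction m with
    | zero => intro M; rfl
    | succ m ih =>
      intro M
      rw [List.replicate_succ, List.foldl_cons, ih, rankingStep]
      split
      · rename_i s hs
        have hsA : s ∈ A := (Finset.mem_sdiff.1 (Finset.mem_toList.1 (List.argmin_mem hs))).1
        rw [Finset.sdiff_insert_of_notMem (Finset.disjoint_left.1 hAB hsA)]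
      · rfl
  have hpoint : ∀ y : Fin n → ℝ,
      ((rankingMatched y (L.map (insert · B) ++ List.replicate m A)).card : ℝ) ≤
        n - (survivors y L B).card := by
    intro y
    have hsurv : B \ rankingMatched y (L.map (insert · B) ++ List.replicate m A) =
        survivors y L B := by
      rw [rankingMatched, List.foldl_append, hstep, sdiff_foldl_rankingStep B L hL hLB ∅ (by simp),
        Finset.sdiff_empty]
    have hcard := card_finset_fin_le
      (rankingMatched y (L.map (insert · B) ++ List.replicate m A) ∪ survivors y L B)
    rw [Finset.card_union_of_disjoint (hsurv ▸ Finset.disjoint_sdiff)] at hcard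
    have : ((rankingMatched y (L.map (insert · B) ++ List.replicate m A)).card : ℝ) +
        (survivors y L B).card ≤ n := by exact_mod_cast hcard
    linarith
  calc _ ≤ ∫ y, ((n : ℝ) - (survivors y L B).card) ∂uniformCube n :=
        integral_mono_of_nonneg (.of_forall fun y => Nat.cast_nonneg _)
          ((integrable_const _).sub hint) (.of_forall hpoint)
    _ = n - ∫ y, ((survivors y L B).card : ℝ) ∂uniformCube n := by
        rw [integral_sub (integrable_const _) hint]; simp
    _ ≤ _ := sub_le_sub_left (survivorBound_le_integral_card_survivors L B hL hLB) _

/-- For every `d ≥ 2` there is a `d`-regular bipartite graph (servers `Fin ns`, requests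
given, in arrival order, by the list `Ns` of their neighborhoods) having a perfect matching
(so its maximum matching has size `ns`), on which the expected size of the matching produced
by Ranking (ranks i.i.d. uniform on `[0,1]`) is at most
`γ(d) = 1 - ((d-1)/(2d-1))·(1-1/d)^d` times `ns`. -/
theorem ranking_at_most_gamma_competitive_on_regular_graphs (d : ℕ) (hd : 2 ≤ d) :
    ∃ (ns : ℕ) (Ns : List (Finset (Fin ns))),
      0 < ns ∧
      (∀ N ∈ Ns, N.card = d) ∧
      (∀ s : Fin ns, (Ns.countP fun N => decide (s ∈ N)) = d) ∧
      (∃ σ : Fin ns → Fin Ns.length, Function.Bijective σ ∧ ∀ s, s ∈ Ns.get (σ s)) ∧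
      ∫ y, ((rankingMatched y Ns).card : ℝ) ∂(uniformCube ns) ≤
        (1 - ((d : ℝ) - 1) / (2 * d - 1) * (1 - 1 / d) ^ d) * ns := by
  obtain ⟨n, rfl⟩ : ∃ n, d = n + 1 := ⟨d - 1, by omega⟩
  have hn : 1 ≤ n := by omega
  let B : Finset (Fin (2 * n + 1)) := {s | s.val < n}
  let A : Finset (Fin (2 * n + 1)) := {s | n ≤ s.val}
  let a : Fin (n + 1) → Fin (2 * n + 1) := fun i => ⟨2 * n - i, by omega⟩
  let L : List (Fin (2 * n + 1)) := List.ofFn a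
  have hAB : Disjoint A B := by
    rw [Finset.disjoint_left]; intro s; simp [A, B]
  have hBcard : B.card = n := by
    simp only [B]
    rw [Fin.card_filter_val_lt]; omega
  have hAcard : A.card = n + 1 := by
    have hcompl : A = Bᶜ := by ext s; simp [A, B]
    rw [hcompl, Finset.card_compl, hBcard, Fintype.card_fin]; omega
  have hL : L.Nodup := List.nodup_ofFn.2 fun i j h => by
    have := congrArg Fin.val h
    simp only [a] at this
    ext; omega
  have hLA : ∀ s, s ∈ L ↔ s ∈ A := by
    intro s
    simp only [L, A, List.mem_ofFn, Finset.mem_filter, Finset.mem_univ, true_and]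
    constructor
    · rintro ⟨i, rfl⟩; simp only [a]; omega
    · intro h
      exact ⟨⟨2 * n - s, by omega⟩, Fin.ext (by simp only [a]; omega)⟩
  have hLB : ∀ s ∈ L, s ∉ B := fun s hs => Finset.disjoint_left.1 hAB ((hLA s).1 hs)
  have hlen : (L.map (insert · B) ++ List.replicate n A).length = 2 * n + 1 := by
    simp [L]; omega
  refine ⟨2 * n + 1, L.map (insert · B) ++ List.replicate n A, by omega, ?_, ?_, ?_, ?_⟩
  · intro N hN
    rcases List.mem_append.1 hN with hN | hN
    · obtain ⟨s, hs, rfl⟩ := List.mem_map.1 hN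
      rw [Finset.card_insert_of_notMem (hLB s hs), hBcard]
    · rw [List.eq_of_mem_replicate hN, hAcard]
  · intro s
    rw [List.countP_append, List.countP_map, List.countP_replicate]
    by_cases hs : s ∈ B
    · have hsA : s ∉ A := fun h => Finset.disjoint_left.1 hAB h hs
      have hall : L.countP ((fun N => decide (s ∈ N)) ∘ (insert · B)) = L.length :=
        List.countP_eq_length.2 fun b _ => by simp [hs]
      rw [hall]
      simp [hsA, L]
    · have hsA : s ∈ A := by simpa [A, B] using hs
      have hone : L.countP ((fun N => decide (s ∈ N)) ∘ (insert · B)) = L.count s := by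
        refine List.countP_congr fun b _ => ?_
        simpa [hs] using eq_comm
      rw [hone, List.count_eq_one_of_mem hL ((hLA s).2 hsA)]
      simp [hsA]; omega
  · refine ⟨Fin.cast hlen.symm, (finCongr hlen.symm).bijective, fun s => ?_⟩
    rw [List.get_eq_getElem]
    by_cases hs : s.val < n + 1
    · rw [List.getElem_append_left (by simpa [L] using hs)]
      by_cases hsn : s.val < n
      · simp [B, hsn]
      · have : s = a ⟨s, hs⟩ := Fin.ext (by simp only [a]; omega)
        simp only [List.getElem_map, L, List.getElem_ofFn, Finset.mem_insert]
        exact Or.inl this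
    · rw [List.getElem_append_right (by simp [L]; omega)]
      simp [A]; omega
  · refine (integral_card_rankingMatched_le L B A hL hLB hAB n).trans (le_of_eq ?_)
    have hq : (1 - 1 / ((n : ℝ) + 1)) = n / (n + 1) := by field_simp; ring
    simp only [survivorBound, hBcard, L, List.length_ofFn]
    push_cast
    rw [hq]
    have h2 : (2 * ((n : ℝ) + 1) - 1) = 2 * n + 1 := by ring
    rw [h2]
    field_simp
    ring
end

section
/- Let d ≥ 2 and let θ_1 ≤ θ_2 ≤ … ≤ θ_{d−1} be the order statistics of d−1 independent random variables uniformly distributed on [0,1]. Then E[F(θ_1, …, θ_{d−1})] ≤ F(1/d, 2/d, …, (d−1)/d). -/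
open MeasureTheory

/-- `markovE d θ n j` is the expected number of downward moves in `n` steps of the Markov
chain on states `d-1, …, 0`, started at state `d-j`, which from state `d-j` stays put with
probability `θ j` and moves down one state with probability `1 - θ j` (state `0`,
i.e. index `j = d`, being absorbing). -/
noncomputable def markovE (d : ℕ) (θ : ℕ → ℝ) : ℕ → ℕ → ℝ
  | 0, _ => 0
  | n + 1, j =>
      if j < d then θ j * markovE d θ n j + (1 - θ j) * (1 + markovE d θ n (j + 1)) else 0

/-- `F(θ₁, …, θ_{d-1})`: the expected number of downward moves in `d` steps starting from
state `d-1`. -/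
noncomputable def markovF (d : ℕ) (θ : ℕ → ℝ) : ℝ := markovE d θ d 1

/-- The order statistics of the tuple `u`, 1-indexed: `orderStat u j` is the `j`-th
smallest of the values `u 0, …, u (n-1)` for `1 ≤ j ≤ n` (and junk `0` otherwise). -/
noncomputable def orderStat {n : ℕ} (u : Fin n → ℝ) : ℕ → ℝ := fun j =>
  if h : 1 ≤ j ∧ j ≤ n then u (Tuple.sort u ⟨j - 1, by omega⟩) else 0

lemma markovE_congr {d : ℕ} {θ η : ℕ → ℝ} (N : ℕ) {j₀ j : ℕ} (hj : j₀ ≤ j)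
    (h : ∀ k, j₀ ≤ k → k < d → θ k = η k) : markovE d θ N j = markovE d η N j := by
  induction N generalizing j with
  | zero => rfl
  | succ N ih =>
    by_cases hd : j < d
    · simp only [markovE, if_pos hd, ih hj, ih (hj.trans j.le_succ), h j hj hd]
    · simp only [markovE, if_neg hd]

lemma markovE_shift (d : ℕ) (θ : ℕ → ℝ) (N j : ℕ) :
    markovE (d + 1) θ N (j + 1) = markovE d (fun k => θ (k + 1)) N j := by
  induction N generalizing j with
  | zero => rfl
  | succ N ih => simp only [markovE, ih, add_lt_add_iff_right]

lemma markovE_mem_Icc {d : ℕ} {θ : ℕ → ℝ} (h : ∀ k, θ k ∈ Set.Icc (0 : ℝ) 1) (N j : ℕ) :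
    markovE d θ N j ∈ Set.Icc (0 : ℝ) N := by
  induction N generalizing j with
  | zero => simp [markovE]
  | succ N ih =>
    obtain ⟨h0, h1⟩ := h j
    obtain ⟨a0, a1⟩ := ih j
    obtain ⟨b0, b1⟩ := ih (j + 1)
    have hN : (0 : ℝ) ≤ N := N.cast_nonneg
    simp only [markovE]
    split_ifs
    · constructor
      · have : 0 ≤ 1 - θ j := by linarith
        positivity
      · push_cast
        nlinarith
    · constructor
      · exact le_rfl
      · positivity

/-- With linear holding probabilities the chain is a coupon collector with `d` coupons. -/
lemma markovE_linear {d : ℕ} (hd : 0 < d) (N : ℕ) {j : ℕ} (hj : j ≤ d) :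
    markovE d (fun k => (k : ℝ) / d) N j = (d - j) * (1 - (1 - 1 / d) ^ N) := by
  induction N generalizing j with
  | zero => simp [markovE]
  | succ N ih =>
    have : (d : ℝ) ≠ 0 := by positivity
    rcases hj.lt_or_eq with h | rfl
    · simp only [markovE, if_pos h, ih hj, ih (Nat.succ_le_of_lt h), pow_succ]
      push_cast
      field_simp
      ring
    · simp [markovE]

lemma orderStat_of_monotone {n : ℕ} {u : Fin n → ℝ} {σ : Equiv.Perm (Fin n)}
    (h : Monotone (u ∘ σ)) (k : Fin n) : orderStat u (k + 1) = u (σ k) := by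
  have hk : 1 ≤ (k : ℕ) + 1 ∧ (k : ℕ) + 1 ≤ n := ⟨by omega, k.2⟩
  rw [orderStat, dif_pos hk]
  exact (congrFun (Tuple.comp_sort_eq_comp_iff_monotone.2 h) k).symm

lemma orderStat_insertNth {n : ℕ} (i : Fin (n + 1)) {x : ℝ} {u : Fin n → ℝ}
    (hx : ∀ j, x ≤ u j) :
    orderStat (i.insertNth (α := fun _ => ℝ) x u) 1 = x ∧
      ∀ k : ℕ, 1 ≤ k → k ≤ n →
        orderStat (i.insertNth (α := fun _ => ℝ) x u) (k + 1) = orderStat u k := by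
  let f : Fin (n + 1) → Fin (n + 1) :=
    Fin.cons (α := fun _ => Fin (n + 1)) i (fun k => i.succAbove (Tuple.sort u k))
  have hf : Function.Injective f := by
    refine Fin.cons_injective_iff.2 ⟨?_, ?_⟩
    · rintro ⟨k, hk⟩
      exact i.succAbove_ne _ hk
    · exact (Fin.succAbove_right_injective).comp (Tuple.sort u).injective
  let σ : Equiv.Perm (Fin (n + 1)) := Equiv.ofBijective f (Finite.injective_iff_bijective.1 hf)
  have hcomp : i.insertNth (α := fun _ => ℝ) x u ∘ σ =
      Fin.cons (α := fun _ => ℝ) x (u ∘ Tuple.sort u) := by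
    funext k
    refine Fin.cases ?_ (fun k => ?_) k
    · simp [σ, f]
    · simp [σ, f]
  have hm : Monotone (i.insertNth (α := fun _ => ℝ) x u ∘ σ) := by
    rw [hcomp]
    intro a b
    refine Fin.cases (fun _ => ?_) (fun a => ?_) a
    · refine Fin.cases ?_ (fun b => ?_) b
      · simp
      · simpa using hx _
    · refine Fin.cases (fun hab => ?_) (fun b hab => ?_) b
      · simp at hab
      · simpa using Tuple.monotone_sort u (Fin.succ_le_succ_iff.1 hab)
  constructor
  · simpa [σ, f] using orderStat_of_monotone hm 0
  · intro k h1 h2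
    have h := orderStat_of_monotone hm (Fin.succ ⟨k - 1, by omega⟩)
    have hk : k - 1 + 1 + 1 = k + 1 := by omega
    simp only [Fin.val_succ, hk] at h
    rw [h, orderStat, dif_pos ⟨h1, h2⟩]
    exact congrFun hcomp (Fin.succ ⟨k - 1, by omega⟩)

lemma orderStat_mem_Icc {n : ℕ} {u : Fin n → ℝ} (h : ∀ i, u i ∈ Set.Icc (0 : ℝ) 1) (j : ℕ) :
    orderStat u j ∈ Set.Icc (0 : ℝ) 1 := by
  unfold orderStat
  split_ifs
  · exact h _
  · simp

lemma measurable_orderStat (n j : ℕ) : Measurable fun u : Fin n → ℝ => orderStat u j := by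
  by_cases hj : 1 ≤ j ∧ j ≤ n
  · intro s hs
    have : (fun u : Fin n → ℝ => orderStat u j) ⁻¹' s =
        ⋃ σ : Equiv.Perm (Fin n), {u | Monotone (u ∘ σ)} ∩ {u | u (σ ⟨j - 1, by omega⟩) ∈ s} := by
      ext u
      simp only [Set.mem_preimage, Set.mem_iUnion, Set.mem_inter_iff, Set.mem_ofPred_eq]
      have key : ∀ σ : Equiv.Perm (Fin n), Monotone (u ∘ σ) →
          orderStat u j = u (σ ⟨j - 1, by omega⟩) := fun σ hσ => by
        rw [← orderStat_of_monotone hσ]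
        congr 1
        simp only
        omega
      constructor
      · exact fun h => ⟨_, Tuple.monotone_sort u, key _ (Tuple.monotone_sort u) ▸ h⟩
      · rintro ⟨σ, hσ, h⟩
        exact (key σ hσ).symm ▸ h
    rw [this]
    refine MeasurableSet.iUnion fun σ => MeasurableSet.inter ?_ (measurable_pi_apply _ hs)
    simp only [Monotone, Set.ofPred_forall]
    refine MeasurableSet.iInter fun a => MeasurableSet.iInter fun b => MeasurableSet.iInter fun _ =>
      measurableSet_le (measurable_pi_apply _) (measurable_pi_apply _)
  · simp only [orderStat, dif_neg hj]
    exact measurable_const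

lemma measurable_markovE_orderStat (d n N j : ℕ) :
    Measurable fun u : Fin n → ℝ => markovE d (orderStat u) N j := by
  induction N generalizing j with
  | zero => exact measurable_const
  | succ N ih =>
    simp only [markovE]
    split_ifs
    · have h1 := measurable_orderStat n j
      have h2 := ih j
      have h3 := ih (j + 1)
      fun_prop
    · exact measurable_const

lemma markovE_insertNth_succ {n : ℕ} (i : Fin (n + 1)) {x : ℝ} {u : Fin n → ℝ}
    (hx : ∀ j, x ≤ u j) (N : ℕ) :
    markovE (n + 2) (orderStat (i.insertNth (α := fun _ => ℝ) x u)) (N + 1) 1 =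
      x * markovE (n + 2) (orderStat (i.insertNth (α := fun _ => ℝ) x u)) N 1 +
        (1 - x) * (1 + markovE (n + 1) (orderStat u) N 1) := by
  obtain ⟨h1, h2⟩ := orderStat_insertNth i hx
  rw [markovE, if_pos (by omega), h1, markovE_shift _ _ _ 1,
    markovE_congr N le_rfl fun k hk hk' => h2 k hk (by omega)]

/-- The uniform (unnormalised) measure on the cube `[a,1]^n`. -/
noncomputable def upperCube (n : ℕ) (a : ℝ) : Measure (Fin n → ℝ) :=
  Measure.pi fun _ => volume.restrict (Set.Icc a 1)

instance (n : ℕ) (a : ℝ) : IsFiniteMeasure (upperCube n a) := by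
  unfold upperCube; infer_instance

lemma ae_mem_upperCube (n : ℕ) (a : ℝ) : ∀ᵐ u ∂upperCube n a, ∀ i, u i ∈ Set.Icc a 1 := by
  rw [ae_all_iff]
  intro i
  exact (Measure.tendsto_eval_ae_ae (μ := fun _ : Fin n => volume.restrict (Set.Icc a 1))
    (i := i)).eventually (ae_restrict_mem measurableSet_Icc)

lemma upperCube_restrict {n : ℕ} {a x : ℝ} (h : a ≤ x) :
    (upperCube n a).restrict {u | ∀ j, x ≤ u j} = upperCube n x := by
  have : {u : Fin n → ℝ | ∀ j, x ≤ u j} = Set.pi Set.univ fun _ => Set.Ici x := by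
    ext; simp [Pi.le_def]
  rw [this, upperCube, Measure.restrict_pi_pi, upperCube]
  congr 1
  funext _
  rw [Measure.restrict_restrict measurableSet_Ici]
  congr 1
  ext y
  simp only [Set.mem_inter_iff, Set.mem_Ici, Set.mem_Icc]
  constructor
  · exact fun hy => ⟨hy.1, hy.2.2⟩
  · exact fun hy => ⟨hy.1, h.trans hy.1, hy.2⟩

lemma upperCube_real_univ (n : ℕ) {a : ℝ} (h : a ≤ 1) :
    (upperCube n a).real Set.univ = (1 - a) ^ n := by
  rw [measureReal_def, upperCube, Measure.pi_univ]
  simp [h]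

lemma markovE_orderStat_mem_Icc {n d : ℕ} {a : ℝ} (ha : 0 ≤ a) {u : Fin n → ℝ}
    (hu : ∀ i, u i ∈ Set.Icc a 1) (N j : ℕ) :
    markovE d (orderStat u) N j ∈ Set.Icc (0 : ℝ) N :=
  markovE_mem_Icc (orderStat_mem_Icc fun i => ⟨ha.trans (hu i).1, (hu i).2⟩) N j

lemma integrable_markovE_orderStat {n : ℕ} {a : ℝ} (ha : 0 ≤ a) (d N j : ℕ) :
    Integrable (fun u => markovE d (orderStat u) N j) (upperCube n a) := by
  refine Integrable.of_bound (measurable_markovE_orderStat d n N j).aestronglyMeasurable N ?_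
  filter_upwards [ae_mem_upperCube n a] with u hu
  obtain ⟨h0, h1⟩ := markovE_orderStat_mem_Icc (d := d) ha hu N j
  rwa [Real.norm_of_nonneg h0]

lemma measurable_insertNth {n : ℕ} (i : Fin (n + 1)) (x : ℝ) :
    Measurable fun u : Fin n → ℝ => i.insertNth (α := fun _ => ℝ) x u := by
  refine measurable_pi_lambda _ fun k => ?_
  refine Fin.succAboveCases i ?_ (fun k => ?_) k
  · simp
  · simpa using measurable_pi_apply k

lemma insertNth_mem_Icc {n : ℕ} (i : Fin (n + 1)) {x : ℝ} (hx : x ≤ 1) {u : Fin n → ℝ}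
    (hu : ∀ j, u j ∈ Set.Icc x 1) (k : Fin (n + 1)) :
    i.insertNth (α := fun _ => ℝ) x u k ∈ Set.Icc x 1 := by
  refine Fin.succAboveCases i ?_ (fun k => ?_) k
  · simp [hx]
  · simpa using hu k

lemma integrable_markovE_insertNth {n : ℕ} (i : Fin (n + 1)) {x : ℝ} (hx : x ∈ Set.Icc (0 : ℝ) 1)
    (d N j : ℕ) :
    Integrable (fun u => markovE d (orderStat (i.insertNth (α := fun _ => ℝ) x u)) N j)
      (upperCube n x) := by
  refine Integrable.of_bound ((measurable_markovE_orderStat d (n + 1) N j).comp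
    (measurable_insertNth i x)).aestronglyMeasurable N ?_
  filter_upwards [ae_mem_upperCube n x] with u hu
  obtain ⟨h0, h1⟩ := markovE_orderStat_mem_Icc (d := d) hx.1 (insertNth_mem_Icc i hx.2 hu) N j
  rwa [Real.norm_of_nonneg h0]

lemma integral_markovE_insertNth_le {n : ℕ} (i : Fin (n + 1)) {x : ℝ}
    (hx : x ∈ Set.Icc (0 : ℝ) 1)
    (h : ∀ N, ∫ u, markovE (n + 1) (orderStat u) N 1 ∂upperCube n x ≤
      (1 - x) ^ n * (n * (1 - (1 - (1 - x) / (n + 1)) ^ N))) (N : ℕ) :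
    ∫ u, markovE (n + 2) (orderStat (i.insertNth (α := fun _ => ℝ) x u)) N 1 ∂upperCube n x ≤
      (1 - x) ^ n * ((n + 1) * (1 - (1 - (1 - x) / (n + 1)) ^ N)) := by
  induction N with
  | zero => simp [markovE]
  | succ N ih =>
    have hrec : ∫ u, markovE (n + 2) (orderStat (i.insertNth (α := fun _ => ℝ) x u)) (N + 1) 1
          ∂upperCube n x =
        x * ∫ u, markovE (n + 2) (orderStat (i.insertNth (α := fun _ => ℝ) x u)) N 1
          ∂upperCube n x +
        (1 - x) * ((1 - x) ^ n + ∫ u, markovE (n + 1) (orderStat u) N 1 ∂upperCube n x) := by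
      have hi := integrable_markovE_insertNth (n := n) i hx (n + 2) N 1
      have hj := integrable_markovE_orderStat (n := n) hx.1 (n + 1) N 1
      have h1 : Integrable (fun _ : Fin n → ℝ => (1 : ℝ)) (upperCube n x) := integrable_const 1
      rw [← upperCube_real_univ n hx.2, ← integral_const_mul]
      have hk : Integrable (fun u => (1 - x) * (1 + markovE (n + 1) (orderStat u) N 1))
          (upperCube n x) := (h1.add hj).const_mul (1 - x)
      have hc : (upperCube n x).real Set.univ = ∫ _, (1 : ℝ) ∂upperCube n x := by simp
      rw [hc, ← integral_add h1 hj, ← integral_const_mul,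
        ← integral_add (hi.const_mul x) hk]
      refine integral_congr_ae ?_
      filter_upwards [ae_mem_upperCube n x] with u hu
      exact markovE_insertNth_succ i (fun j => (hu j).1) N
    rw [hrec]
    have hn : (n : ℝ) + 1 ≠ 0 := by positivity
    calc _ ≤ x * ((1 - x) ^ n * ((n + 1) * (1 - (1 - (1 - x) / (n + 1)) ^ N))) +
          (1 - x) * ((1 - x) ^ n + (1 - x) ^ n * (n * (1 - (1 - (1 - x) / (n + 1)) ^ N))) := by
          have h0 := hx.1
          have h1 : 0 ≤ 1 - x := sub_nonneg.2 hx.2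
          gcongr
          exact h N
      _ = _ := by
          rw [pow_succ]
          field_simp
          ring

/-- Splitting the cube according to which coordinate is smallest. -/
lemma integral_upperCube_succ_le {n : ℕ} {a : ℝ} {f : (Fin (n + 1) → ℝ) → ℝ}
    (hf : Integrable f (upperCube (n + 1) a)) (h0 : ∀ᵐ u ∂upperCube (n + 1) a, 0 ≤ f u) :
    ∫ u, f u ∂upperCube (n + 1) a ≤
      ∑ i : Fin (n + 1), ∫ x in Set.Icc a 1,
        ∫ u, f (i.insertNth (α := fun _ => ℝ) x u) ∂upperCube n x := by
  let M : Fin (n + 1) → Set (Fin (n + 1) → ℝ) := fun i => {u | ∀ k, u i ≤ u k}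
  have hM : ∀ i, MeasurableSet (M i) := fun i => by
    simp only [M, Set.ofPred_forall]
    exact MeasurableSet.iInter fun k =>
      measurableSet_le (measurable_pi_apply _) (measurable_pi_apply _)
  have hterm : ∀ i, ∫ u, (M i).indicator f u ∂upperCube (n + 1) a = ∫ x in Set.Icc a 1,
        ∫ u, f (i.insertNth (α := fun _ => ℝ) x u) ∂upperCube n x := by
    intro i
    have hp := (measurePreserving_piFinSuccAbove
      (fun _ : Fin (n + 1) => volume.restrict (Set.Icc a 1)) i).symm
    have hint : Integrable (fun z => (M i).indicator f
        ((MeasurableEquiv.piFinSuccAbove (fun _ => ℝ) i).symm z)) _ :=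
      hp.integrable_comp_of_integrable (hf.indicator (hM i))
    rw [upperCube, ← hp.integral_comp', integral_prod _ hint]
    refine setIntegral_congr_fun measurableSet_Icc fun x hx => ?_
    have hset : MeasurableSet {u : Fin n → ℝ | ∀ j, x ≤ u j} := by
      simp only [Set.ofPred_forall]
      exact MeasurableSet.iInter fun k => measurableSet_le measurable_const (measurable_pi_apply _)
    rw [← upperCube_restrict hx.1, ← integral_indicator hset]
    refine integral_congr_ae (Filter.Eventually.of_forall fun u => ?_)
    simp only [MeasurableEquiv.piFinSuccAbove_symm_apply, Set.indicator_apply, M,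
      Set.mem_ofPred_eq, Fin.forall_iff_succAbove i]
    simp [Fin.insertNthEquiv]
  simp only [← hterm]
  rw [← integral_finsetSum _ fun i _ => hf.indicator (hM i)]
  refine integral_mono_ae hf (integrable_finsetSum _ fun i _ => hf.indicator (hM i)) ?_
  filter_upwards [h0] with u hu
  obtain ⟨i, hi⟩ := Finite.exists_min u
  calc f u = (M i).indicator f u := (Set.indicator_of_mem (s := M i) hi f).symm
    _ ≤ _ := Finset.single_le_sum (f := fun i => (M i).indicator f u)
      (fun k _ => Set.indicator_apply_nonneg fun _ => hu) (Finset.mem_univ i)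

lemma exists_tangent_le_pow {μ : ℝ} (hμ : 0 ≤ μ) (N : ℕ) :
    ∃ s : ℝ, 0 ≤ s ∧ ∀ x : ℝ, 0 ≤ x → μ ^ N + s * (x - μ) ≤ x ^ N := by
  induction N with
  | zero => exact ⟨0, le_rfl, fun x _ => by simp⟩
  | succ N ih =>
    obtain ⟨s, hs, h⟩ := ih
    refine ⟨μ ^ N + s * μ, by positivity, fun x hx => ?_⟩
    have h1 := mul_le_mul_of_nonneg_left (h x hx) hx
    have h2 := mul_nonneg hs (sq_nonneg (x - μ))
    rw [pow_succ, pow_succ]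
    nlinarith

lemma setIntegral_one_sub_pow {a : ℝ} (ha : a ≤ 1) (m : ℕ) :
    ∫ x in Set.Icc a 1, (1 - x) ^ m = (1 - a) ^ (m + 1) / (m + 1) := by
  rw [integral_Icc_eq_integral_Ioc, ← intervalIntegral.integral_of_le ha,
    intervalIntegral.integral_comp_sub_left (fun x => x ^ m), integral_pow]
  simp

/-- Jensen's inequality for the convex function `x ↦ x ^ N` against a beta distribution. -/
lemma setIntegral_beta_le {a : ℝ} (ha : a ∈ Set.Icc (0 : ℝ) 1) (n N : ℕ) :
    ∫ x in Set.Icc a 1, (1 - x) ^ n * ((n + 1) * (1 - (1 - (1 - x) / (n + 1)) ^ N)) ≤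
      (1 - a) ^ (n + 1) * (1 - (1 - (1 - a) / (n + 2)) ^ N) := by
  have hn : (0 : ℝ) ≤ n := n.cast_nonneg
  set μ : ℝ := 1 - (1 - a) / (n + 2) with hμ
  have hμ0 : 0 ≤ μ := by
    rw [hμ, sub_nonneg, div_le_one (by positivity)]
    linarith [ha.1]
  obtain ⟨s, -, hs⟩ := exists_tangent_le_pow hμ0 N
  have hint : ∀ g : ℝ → ℝ, Continuous g → IntegrableOn g (Set.Icc a 1) := fun g hg =>
    hg.continuousOn.integrableOn_Icc
  calc _ ≤ ∫ x in Set.Icc a 1, ((n + 1) * (1 - μ ^ N - s * (1 - μ)) * (1 - x) ^ n +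
        s * (1 - x) ^ (n + 1)) := by
        refine setIntegral_mono_on (hint _ (by fun_prop)) (hint _ (by fun_prop))
          measurableSet_Icc fun x hx => ?_
        have h1 : 0 ≤ 1 - (1 - x) / ((n : ℝ) + 1) := by
          rw [sub_nonneg, div_le_one (by positivity)]
          linarith [ha.1, hx.1]
        have h2 : 0 ≤ (1 - x) ^ n * ((n : ℝ) + 1) :=
          mul_nonneg (pow_nonneg (sub_nonneg.2 hx.2) n) (by positivity)
        have h3 := mul_le_mul_of_nonneg_left (hs _ h1) h2
        have h4 : (1 - x) ^ n * ((n : ℝ) + 1) * (s * (1 - (1 - x) / ((n : ℝ) + 1))) =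
            s * ((n + 1) * (1 - x) ^ n - (1 - x) ^ (n + 1)) := by
          rw [pow_succ]
          field_simp
        linarith
    _ = _ := by
        rw [integral_add (hint _ (by fun_prop)) (hint _ (by fun_prop)), integral_const_mul,
          integral_const_mul, setIntegral_one_sub_pow ha.2, setIntegral_one_sub_pow ha.2]
        have : 1 - μ = (1 - a) / (n + 2) := by rw [hμ]; ring
        rw [this]
        push_cast
        have h5 : (n : ℝ) + 1 + 1 = n + 2 := by ring
        rw [h5]
        field_simp
        ring

theorem integral_markovE_orderStat_le (n N : ℕ) {a : ℝ} (ha : a ∈ Set.Icc (0 : ℝ) 1) :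
    ∫ u, markovE (n + 1) (orderStat u) N 1 ∂upperCube n a ≤
      (1 - a) ^ n * (n * (1 - (1 - (1 - a) / (n + 1)) ^ N)) := by
  induction n generalizing N a with
  | zero =>
    have : ∀ u : Fin 0 → ℝ, markovE 1 (orderStat u) N 1 = 0 := fun u => by
      cases N <;> simp [markovE]
    simp [this]
  | succ n ih =>
    have hnn : ∀ x ∈ Set.Icc a 1, x ∈ Set.Icc (0 : ℝ) 1 := fun x hx => ⟨ha.1.trans hx.1, hx.2⟩
    have h1 : ∀ i : Fin (n + 1), ∫ x in Set.Icc a 1, ∫ u, markovE (n + 2)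
          (orderStat (i.insertNth (α := fun _ => ℝ) x u)) N 1 ∂upperCube n x ≤
        (1 - a) ^ (n + 1) * (1 - (1 - (1 - a) / (n + 2)) ^ N) := fun i => by
      refine le_trans (integral_mono_of_nonneg ?_ ?_ ?_) (setIntegral_beta_le ha n N)
      · filter_upwards [ae_restrict_mem measurableSet_Icc] with x hx
        refine integral_nonneg_of_ae ?_
        filter_upwards [ae_mem_upperCube n x] with u hu
        exact (markovE_orderStat_mem_Icc (hnn x hx).1 (insertNth_mem_Icc i hx.2 hu) N 1).1
      · exact Continuous.integrableOn_Icc (by fun_prop)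
      · filter_upwards [ae_restrict_mem measurableSet_Icc] with x hx
        exact integral_markovE_insertNth_le i (hnn x hx) (fun N => ih N (hnn x hx)) N
    calc _ ≤ _ := integral_upperCube_succ_le (integrable_markovE_orderStat ha.1 (n + 2) N 1) <| by
          filter_upwards [ae_mem_upperCube (n + 1) a] with u hu
          exact (markovE_orderStat_mem_Icc ha.1 hu N 1).1
      _ ≤ ∑ _i : Fin (n + 1), (1 - a) ^ (n + 1) * (1 - (1 - (1 - a) / (n + 2)) ^ N) :=
          Finset.sum_le_sum fun i _ => h1 i
      _ = _ := by
          have : (n : ℝ) + 1 + 1 = n + 2 := by ring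
          simp only [Finset.sum_const, Finset.card_univ, Fintype.card_fin, nsmul_eq_mul]
          push_cast
          rw [this]
          ring

/-- For `d ≥ 2` and `θ₁ ≤ … ≤ θ_{d-1}` the order statistics of `d-1` i.i.d. uniform random
variables on `[0,1]`, we have `E[F(θ₁, …, θ_{d-1})] ≤ F(1/d, …, (d-1)/d)`. -/
theorem expected_markovF_le_markovF_at_linear_theta (d : ℕ) (hd : 2 ≤ d) :
    ∫ u, markovF d (orderStat u) ∂(uniformCube (d - 1)) ≤
      markovF d (fun j => (j : ℝ) / d) := by
  obtain ⟨n, rfl⟩ : ∃ n, d = n + 1 := ⟨d - 1, by omega⟩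
  have h := integral_markovE_orderStat_le n (n + 1) (a := 0) (by simp)
  rw [markovF, markovE_linear n.succ_pos _ (by omega)]
  simpa [markovF, uniformCube, upperCube] using h
end

section
/- The Ranking algorithm is at most (119/144)-competitive for online bipartite matching on 2-regular graphs: there exists a 2-regular bipartite graph with 8 servers and 8 requests (with a specified arrival order) on which the expected size of the matching produced by Ranking equals (119/144) · 8, while the graph has a perfect matching of size 8. -/
open MeasureTheory

open ProbabilityTheory

/-- The action of a request with neighbors `a` and `b` on the set `M` of matched servers, where `c`
records whether `a` is preferred to `b`. -/
def pairStep {n : ℕ} (c : Bool) (M : Finset (Fin n)) (a b : Fin n) : Finset (Fin n) :=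
  if a ∈ M then insert b M else if b ∈ M then insert a M
  else if c then insert a M else insert b M

lemma rankingStep_of_forall_lt {n : ℕ} {y : Fin n → ℝ} {M N : Finset (Fin n)} {a : Fin n}
    (ha : a ∈ N \ M) (h : ∀ b ∈ N \ M, b ≠ a → y a < y b) :
    rankingStep y M N = insert a M := by
  unfold rankingStep
  cases hm : List.argmin y (N \ M).toList with
  | none =>
    rw [List.argmin_eq_none, Finset.toList_eq_nil] at hm
    simp [hm] at ha
  | some s =>
    have hs : s ∈ N \ M := Finset.mem_toList.1 (List.argmin_mem hm)
    have hle : y s ≤ y a := List.le_of_mem_argmin (Finset.mem_toList.2 ha) hm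
    have hsa : s = a := by
      by_contra hne
      exact (h s hs hne).not_ge hle
    rw [hsa]

lemma rankingStep_of_subset {n : ℕ} {y : Fin n → ℝ} {M N : Finset (Fin n)} (h : N ⊆ M) :
    rankingStep y M N = M := by
  simp [rankingStep, Finset.sdiff_eq_empty_iff_subset.2 h]

lemma rankingStep_pair {n : ℕ} {y : Fin n → ℝ} (hy : Function.Injective y) (M : Finset (Fin n))
    {a b : Fin n} (hab : a ≠ b) :
    rankingStep y M {a, b} = pairStep (decide (y a < y b)) M a b := by
  unfold pairStep
  by_cases ha : a ∈ M
  · by_cases hb : b ∈ M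
    · rw [rankingStep_of_subset (by grind)]
      simp [ha, hb]
    · rw [rankingStep_of_forall_lt (a := b) (by grind) (by grind)]
      simp [ha]
  · by_cases hb : b ∈ M
    · rw [rankingStep_of_forall_lt (a := a) (by grind) (by grind)]
      simp [ha, hb]
    · rcases lt_or_gt_of_ne (hy.ne hab) with h | h
      · rw [rankingStep_of_forall_lt (a := a) (by grind) (by grind)]
        simp [ha, hb, h]
      · rw [rankingStep_of_forall_lt (a := b) (by grind) (by grind)]
        simp [ha, hb, h.le]

instance isProbabilityMeasure_uniformCube_factor :
    IsProbabilityMeasure (volume.restrict (Set.Icc (0 : ℝ) 1)) :=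
  ⟨by simp⟩

instance isProbabilityMeasure_uniformCube (n : ℕ) : IsProbabilityMeasure (uniformCube n) := by
  unfold uniformCube
  infer_instance

lemma iIndepFun_uniformCube (n : ℕ) : iIndepFun (fun i (y : Fin n → ℝ) ↦ y i) (uniformCube n) :=
  iIndepFun_pi (X := fun _ ↦ id) fun _ ↦ aemeasurable_id

lemma map_eval_uniformCube {n : ℕ} (i : Fin n) :
    (uniformCube n).map (fun y ↦ y i) = volume.restrict (Set.Icc (0 : ℝ) 1) :=
  (measurePreserving_eval (fun _ : Fin n ↦ volume.restrict (Set.Icc (0 : ℝ) 1)) i).map_eq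

lemma map_pair_uniformCube {n : ℕ} {i j : Fin n} (hij : i ≠ j) :
    (uniformCube n).map (fun y ↦ (y i, y j)) =
      (volume.restrict (Set.Icc (0 : ℝ) 1)).prod (volume.restrict (Set.Icc (0 : ℝ) 1)) := by
  rw [((iIndepFun_uniformCube n).indepFun hij).map_prod_eq_prod_map_map
    (measurable_pi_apply i).aemeasurable (measurable_pi_apply j).aemeasurable, map_eval_uniformCube, map_eval_uniformCube]

lemma ae_injective_uniformCube (n : ℕ) : ∀ᵐ y ∂uniformCube n, Function.Injective y := by
  have h : ∀ i j : Fin n, ∀ᵐ y ∂uniformCube n, y i = y j → i = j := by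
    intro i j
    by_cases hij : i = j
    · simp [hij]
    have hm : MeasurableSet {p : ℝ × ℝ | p.1 = p.2} :=
      measurableSet_eq_fun measurable_fst measurable_snd
    have h0 : uniformCube n ((fun y ↦ (y i, y j)) ⁻¹' {p : ℝ × ℝ | p.1 = p.2}) = 0 := by
      rw [← Measure.map_apply (by fun_prop) hm, map_pair_uniformCube hij,
        Measure.measure_prod_null hm]
      refine Filter.Eventually.of_forall fun x ↦ ?_
      have : Prod.mk x ⁻¹' {p : ℝ × ℝ | p.1 = p.2} = {x} := by
        ext z
        simp [eq_comm]
      simp [this]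
    filter_upwards [measure_eq_zero_iff_ae_notMem.1 h0] with y hy hyij
    exact absurd hyij hy
  filter_upwards [ae_all_iff.2 fun i ↦ ae_all_iff.2 (h i)] with y hy i j using hy i j

/-- The event that the ranks of the servers `i`, `j`, `k` are increasing. -/
def chain {n : ℕ} (i j k : Fin n) : Set (Fin n → ℝ) := {y | y i < y j ∧ y j < y k}

lemma measurableSet_chain {n : ℕ} (i j k : Fin n) : MeasurableSet (chain i j k) :=
  (measurableSet_lt (measurable_pi_apply i) (measurable_pi_apply j)).inter
    (measurableSet_lt (measurable_pi_apply j) (measurable_pi_apply k))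

lemma measure_chain {n : ℕ} {i j k : Fin n} (hij : i ≠ j) (hjk : j ≠ k) (hik : i ≠ k) :
    uniformCube n (chain i j k) = ENNReal.ofReal (1 / 6) := by
  set T : Set ((ℝ × ℝ) × ℝ) := {p | p.1.1 < p.2 ∧ p.2 < p.1.2} with hT
  have hTm : MeasurableSet T :=
    (measurableSet_lt (f := fun p : (ℝ × ℝ) × ℝ ↦ p.1.1) (g := fun p ↦ p.2) (by fun_prop)
      (by fun_prop)).inter (measurableSet_lt (f := fun p : (ℝ × ℝ) × ℝ ↦ p.2)
        (g := fun p ↦ p.1.2) (by fun_prop) (by fun_prop))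
  have hmap : (uniformCube n).map (fun y ↦ ((y i, y k), y j)) =
      ((volume.restrict (Set.Icc (0 : ℝ) 1)).prod (volume.restrict (Set.Icc (0 : ℝ) 1))).prod
        (volume.restrict (Set.Icc (0 : ℝ) 1)) := by
    rw [((iIndepFun_uniformCube n).indepFun_prodMk (fun _ ↦ by fun_prop) i k j hij
      hjk.symm).map_prod_eq_prod_map_map (by fun_prop)
      (measurable_pi_apply j).aemeasurable, map_eval_uniformCube,
      map_pair_uniformCube hik]
  have hpre : chain i j k = (fun y ↦ ((y i, y k), y j)) ⁻¹' T := rfl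
  have hsec (t : ℝ) : (fun p : ℝ × ℝ ↦ (p, t)) ⁻¹' T = Set.Iio t ×ˢ Set.Ioi t := rfl
  rw [hpre, ← Measure.map_apply (by fun_prop) hTm, hmap, Measure.prod_apply_symm hTm]
  simp only [hsec, Measure.prod_prod]
  have hval : ∀ t ∈ Set.Icc (0 : ℝ) 1,
      volume.restrict (Set.Icc (0 : ℝ) 1) (Set.Iio t) *
        volume.restrict (Set.Icc (0 : ℝ) 1) (Set.Ioi t) = ENNReal.ofReal (t * (1 - t)) := by
    intro t ht
    have h1 : Set.Iio t ∩ Set.Icc 0 1 = Set.Ico 0 t := by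
      ext x
      simp only [Set.mem_inter_iff, Set.mem_Iio, Set.mem_Icc, Set.mem_Ico]
      grind
    have h2 : Set.Ioi t ∩ Set.Icc 0 1 = Set.Ioc t 1 := by
      ext x
      simp only [Set.mem_inter_iff, Set.mem_Ioi, Set.mem_Icc, Set.mem_Ioc]
      grind
    rw [Measure.restrict_apply measurableSet_Iio, Measure.restrict_apply measurableSet_Ioi, h1, h2,
      Real.volume_Ico, Real.volume_Ioc, sub_zero, ENNReal.ofReal_mul ht.1]
  rw [setLIntegral_congr_fun measurableSet_Icc hval, ← ofReal_integral_eq_lintegral_ofReal]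
  · rw [integral_Icc_eq_integral_Ioc, ← intervalIntegral.integral_of_le zero_le_one]
    congr 1
    simp only [mul_sub, mul_one, ← sq]
    rw [intervalIntegral.integral_sub (by simp) (by simp), integral_id, integral_pow]
    norm_num
  · exact (by fun_prop : Continuous fun t : ℝ ↦ t * (1 - t)).continuousOn.integrableOn_Icc
  · filter_upwards [ae_restrict_mem measurableSet_Icc] with t ht
    exact mul_nonneg ht.1 (sub_nonneg.2 ht.2)

lemma measure_chain_inter_chain {n : ℕ} {i j k i' j' k' : Fin n}
    (h : Disjoint ({i, j, k} : Finset (Fin n)) {i', j', k'}) :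
    uniformCube n (chain i j k ∩ chain i' j' k') =
      uniformCube n (chain i j k) * uniformCube n (chain i' j' k') := by
  have hind := (iIndepFun_uniformCube n).indepFun_finset _ _ h fun _ ↦ by fun_prop
  have hm {S : Finset (Fin n)} (a b c : S) :
      MeasurableSet {z : S → ℝ | z a < z b ∧ z b < z c} :=
    (measurableSet_lt (measurable_pi_apply a) (measurable_pi_apply b)).inter
      (measurableSet_lt (measurable_pi_apply b) (measurable_pi_apply c))
  exact hind.measure_inter_preimage_eq_mul _ _
    (hm ⟨i, by simp⟩ ⟨j, by simp⟩ ⟨k, by simp⟩) (hm ⟨i', by simp⟩ ⟨j', by simp⟩ ⟨k', by simp⟩)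

lemma measureReal_chain_union_chain {n : ℕ} {i j k i' j' k' : Fin n}
    (hij : i ≠ j) (hjk : j ≠ k) (hik : i ≠ k) (hij' : i' ≠ j') (hjk' : j' ≠ k') (hik' : i' ≠ k')
    (h : Disjoint ({i, j, k} : Finset (Fin n)) {i', j', k'}) :
    (uniformCube n).real (chain i j k ∪ chain i' j' k') = 11 / 36 := by
  have hu := measureReal_union_add_inter (μ := uniformCube n) (s := chain i j k)
    (measurableSet_chain i' j' k')
  simp only [measureReal_def, measure_chain_inter_chain h, measure_chain hij hjk hik,
    measure_chain hij' hjk' hik', ENNReal.toReal_mul] at hu ⊢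
  rw [ENNReal.toReal_ofReal (by norm_num)] at hu
  linarith

/-- The requests of an `8`-cycle on the servers, in their order of arrival. -/
def cycleRequests : List (Finset (Fin 8)) :=
  [{0, 1}, {4, 5}, {1, 2}, {3, 4}, {5, 6}, {7, 0}, {2, 3}, {6, 7}]

lemma card_foldl_pairStep_cycle (c₀ c₁ c₂ c₃ c₄ c₅ c₆ c₇ : Bool) :
    (pairStep c₆ (pairStep c₂ (pairStep c₇ (pairStep c₅ (pairStep c₃ (pairStep c₁
      (pairStep c₄ (pairStep c₀ (∅ : Finset (Fin 8)) 0 1) 4 5) 1 2) 3 4) 5 6) 7 0) 2 3) 6 7).card =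
      6 + (if (c₀ && c₁) || (!c₄ && !c₃) then 1 else 0) +
        (if (c₄ && c₅) || (!c₀ && !c₇) then 1 else 0) := by
  revert c₀ c₁ c₂ c₃ c₄ c₅ c₆ c₇
  decide +kernel

lemma card_rankingMatched_cycleRequests {y : Fin 8 → ℝ} (hy : Function.Injective y) :
    ((rankingMatched y cycleRequests).card : ℝ) =
      6 + (chain 0 1 2 ∪ chain 5 4 3).indicator 1 y +
        (chain 4 5 6 ∪ chain 1 0 7).indicator 1 y := by
  have hlt {a b : Fin 8} (hab : a ≠ b) : ¬ y a < y b ↔ y b < y a :=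
    not_lt.trans ⟨fun h ↦ h.lt_of_ne (hy.ne hab.symm), le_of_lt⟩
  simp only [rankingMatched, cycleRequests, List.foldl_cons, List.foldl_nil]
  rw [rankingStep_pair hy _ (by decide), rankingStep_pair hy _ (by decide),
    rankingStep_pair hy _ (by decide), rankingStep_pair hy _ (by decide),
    rankingStep_pair hy _ (by decide), rankingStep_pair hy _ (by decide),
    rankingStep_pair hy _ (by decide), rankingStep_pair hy _ (by decide),
    card_foldl_pairStep_cycle]
  have h45 := hlt (a := 4) (b := 5) (by decide)
  have h34 := hlt (a := 3) (b := 4) (by decide)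
  have h01 := hlt (a := 0) (b := 1) (by decide)
  have h70 := hlt (a := 7) (b := 0) (by decide)
  simp only [Set.indicator_apply, chain, Set.mem_union, Set.mem_ofPred_eq, Bool.or_eq_true,
    Bool.and_eq_true, Bool.not_eq_true', decide_eq_true_eq, decide_eq_false_iff_not, h45, h34, h01,
    h70, Pi.one_apply]
  push_cast
  rfl

/-- There is a `2`-regular bipartite graph with `8` servers and `8` requests (arriving in
the order of the list `Ns`), which has a perfect matching of size `8`, on which the
expected size of the matching produced by Ranking equals `(119/144) · 8`; hence Ranking
is at most `119/144`-competitive on `2`-regular graphs. -/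
theorem ranking_at_most_119_div_144_competitive_on_two_regular_graphs :
    ∃ Ns : List (Finset (Fin 8)),
      Ns.length = 8 ∧
      (∀ N ∈ Ns, N.card = 2) ∧
      (∀ s : Fin 8, (Ns.countP fun N => decide (s ∈ N)) = 2) ∧
      (∃ σ : Fin 8 → Fin Ns.length, Function.Bijective σ ∧ ∀ s, s ∈ Ns.get (σ s)) ∧
      ∫ y, ((rankingMatched y Ns).card : ℝ) ∂(uniformCube 8) = (119 / 144) * 8 := by
  refine ⟨cycleRequests, rfl, by decide +kernel, by decide +kernel,
    ⟨(![0, 2, 6, 3, 1, 4, 7, 5] : Fin 8 → Fin 8),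
      (Finite.injective_iff_bijective (α := Fin 8)).1 (by decide), by decide +kernel⟩, ?_⟩
  have hm (i j k i' j' k' : Fin 8) : MeasurableSet (chain i j k ∪ chain i' j' k') :=
    (measurableSet_chain i j k).union (measurableSet_chain i' j' k')
  have hind (i j k i' j' k' : Fin 8) :
      Integrable ((chain i j k ∪ chain i' j' k').indicator (1 : (Fin 8 → ℝ) → ℝ))
        (uniformCube 8) :=
    (integrable_const 1).indicator (hm i j k i' j' k')
  have hsum (i j k i' j' k' : Fin 8) :
      Integrable (fun y ↦ 6 + (chain i j k ∪ chain i' j' k').indicator (1 : (Fin 8 → ℝ) → ℝ) y)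
        (uniformCube 8) :=
    (integrable_const 6).add (hind i j k i' j' k')
  rw [integral_congr_ae ((ae_injective_uniformCube 8).mono fun y hy ↦
      card_rankingMatched_cycleRequests hy),
    integral_add (hsum ..) (hind ..), integral_add (integrable_const 6) (hind ..),
    integral_indicator_one (hm ..), integral_indicator_one (hm ..),
    measureReal_chain_union_chain (by decide) (by decide) (by decide) (by decide) (by decide)
      (by decide) (by decide),
    measureReal_chain_union_chain (by decide) (by decide) (by decide) (by decide) (by decide)
      (by decide) (by decide)]
  norm_num
end

section
/- For every integer d ≥ 2 and every randomized online algorithm for online bipartite matching, there exists a d-regular bipartite graph instance (with a specified arrival order of the requests) on which the expected size of the matching produced by the algorithm is at most η(d) times the size of a maximum matching, where η(d) = 1 − ∑_{i=⌈d/2⌉+1}^{d} ((i−⌈d/2⌉)/d) · C(d,i) · (⌊d/2⌋/d)^{d−i} · (1−⌊d/2⌋/d)^{i} and C(d,i) denotes the binomial coefficient. -/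
open MeasureTheory

/-- Run a deterministic online matching algorithm `alg` (which sees only the list of
neighborhoods revealed so far, the current request's neighborhood being the last entry,
and proposes a server or passes).  `hist` is the list of already revealed neighborhoods,
the second argument the remaining requests, `M` the currently matched servers.
A proposal is carried out only if it is a valid online move (the proposed server is an
unmatched neighbor of the current request). Returns the final set of matched servers. -/
def detRun {n : ℕ} (alg : List (Finset (Fin n)) → Option (Fin n)) :
    List (Finset (Fin n)) → List (Finset (Fin n)) → Finset (Fin n) → Finset (Fin n)
  | _, [], M => M
  | hist, N :: rest, M =>
      detRun alg (hist ++ [N]) rest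
        (match alg (hist ++ [N]) with
          | some s => if s ∈ N ∧ s ∉ M then insert s M else M
          | none => M)

/-- `η(d) = 1 - ∑_{i=⌈d/2⌉+1}^{d} ((i-⌈d/2⌉)/d)·C(d,i)·(⌊d/2⌋/d)^{d-i}·(1-⌊d/2⌋/d)^i`. -/
noncomputable def etaBound (d : ℕ) : ℝ :=
  1 - ∑ i ∈ Finset.Icc ((d + 1) / 2 + 1) d,
        ((i : ℝ) - ((d + 1) / 2 : ℕ)) / d * (d.choose i) *
          (((d / 2 : ℕ) : ℝ) / d) ^ (d - i) * (1 - ((d / 2 : ℕ) : ℝ) / d) ^ i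

/-- `m` rounds of requests, each round presenting the neighborhoods `h 0, …, h (d - 1)`. -/
def roundRobin {α : Type*} {d : ℕ} (m : ℕ) (h : Fin d → α) : List α :=
  List.ofFn fun r : Fin (m * d) => h r.modNat

/-- With the servers arranged in a `d × d` grid by `E`, request every row `f` times and then
every column `c` times. -/
def gridRequests {n d : ℕ} (f c : ℕ) (E : Fin n ≃ Fin d × Fin d) : List (Finset (Fin n)) :=
  roundRobin f (fun u => Finset.univ.filter fun x => (E x).1 = u) ++
    roundRobin c (fun u => Finset.univ.filter fun x => (E x).2 = u)

/-- The grid of servers in which row `i` is cyclically shifted by `k i`. -/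
def shiftedGrid {d : ℕ} [NeZero d] (k : Fin d → Fin d) : Fin (d * d) ≃ Fin d × Fin d :=
  finProdFinEquiv.symm.trans (Equiv.prodShear (Equiv.refl _) fun i => Equiv.subRight (k i))

lemma countP_roundRobin {α : Type*} {d : ℕ} (m : ℕ) (h : Fin d → α) (p : α → Bool) (v : Fin d)
    (hp : ∀ u, p (h u) = decide (u = v)) : (roundRobin m h).countP p = m := by
  have hround : (List.ofFn h).countP p = 1 := by
    rw [List.ofFn_eq_map, List.countP_map]
    have : (p ∘ h) = fun u => u == v := by
      funext u
      rw [Function.comp_apply, hp, Bool.eq_iff_iff]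
      simp
    rw [this]
    exact List.count_eq_one_of_mem (List.nodup_finRange d) (List.mem_finRange v)
  have hmod : ∀ (i : Fin m) (j : Fin d) (hlt : i.val * d + j.val < m * d),
      (⟨i.val * d + j.val, hlt⟩ : Fin (m * d)).modNat = j := by
    intro i j hlt
    ext
    simp [Fin.modNat, Nat.mod_eq_of_lt j.isLt]
  unfold roundRobin
  rw [List.ofFn_mul]
  simp only [hmod, List.countP_flatten, List.map_ofFn, Function.comp_def, hround]
  simp [List.ofFn_const]

lemma mem_roundRobin {α : Type*} {d m : ℕ} {h : Fin d → α} {a : α} (ha : a ∈ roundRobin m h) :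
    ∃ u, h u = a := by
  obtain ⟨r, hr⟩ := List.mem_ofFn.1 ha
  exact ⟨_, hr⟩

lemma detRun_append {n : ℕ} (alg : List (Finset (Fin n)) → Option (Fin n))
    (l₁ l₂ : List (Finset (Fin n))) : ∀ (hist : List (Finset (Fin n))) (M : Finset (Fin n)),
    detRun alg hist (l₁ ++ l₂) M = detRun alg (hist ++ l₁) l₂ (detRun alg hist l₁ M) := by
  induction l₁ with
  | nil => simp [detRun]
  | cons N l ih => intro hist M; simp [detRun, ih]

lemma card_detRun_inter_le {n : ℕ} (alg : List (Finset (Fin n)) → Option (Fin n))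
    (T : Finset (Fin n)) (l : List (Finset (Fin n))) :
    ∀ (hist : List (Finset (Fin n))) (M : Finset (Fin n)),
    (detRun alg hist l M ∩ T).card ≤
      (M ∩ T).card + l.countP fun N => decide (N ∩ T).Nonempty := by
  induction l with
  | nil => simp [detRun]
  | cons N l ih =>
    intro hist M
    rw [detRun, List.countP_cons]
    refine (ih _ _).trans ?_
    have key : ∀ s, ((if s ∈ N ∧ s ∉ M then insert s M else M) ∩ T).card ≤
        (M ∩ T).card + if decide (N ∩ T).Nonempty = true then 1 else 0 := by
      intro s
      split_ifs with h₁ h₂ h₂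
      · exact (Finset.card_le_card (t := insert s (M ∩ T)) (by grind)).trans
          (Finset.card_insert_le _ _)
      · have : s ∉ T := fun hT => h₂ (decide_eq_true ⟨s, Finset.mem_inter.2 ⟨h₁.1, hT⟩⟩)
        rw [Finset.insert_inter_of_notMem this, add_zero]
      · omega
      · omega
    cases alg (hist ++ [N]) with
    | none => simp only; omega
    | some s => have := key s; simp only; omega

lemma card_detRun_inter_fiber_le {n d m : ℕ} (alg : List (Finset (Fin n)) → Option (Fin n))
    (g : Fin n → Fin d) (v : Fin d) (hv : ∃ x, g x = v) (hist : List (Finset (Fin n)))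
    (M : Finset (Fin n)) :
    (detRun alg hist (roundRobin m fun u => Finset.univ.filter fun x => g x = u) M ∩
      Finset.univ.filter fun x => g x = v).card ≤
      (M ∩ Finset.univ.filter fun x => g x = v).card + m := by
  refine (card_detRun_inter_le _ _ _ _ _).trans_eq ?_
  rw [countP_roundRobin m _ _ v]
  intro u
  rw [decide_eq_decide]
  constructor
  · rintro ⟨x, hx⟩
    simp only [Finset.mem_inter, Finset.mem_filter, Finset.mem_univ, true_and] at hx
    exact hx.1.symm.trans hx.2
  · rintro rfl
    obtain ⟨x, hx⟩ := hv
    exact ⟨x, by simp [hx]⟩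

lemma card_row {n d : ℕ} (E : Fin n ≃ Fin d × Fin d) (u : Fin d) :
    (Finset.univ.filter fun x => (E x).1 = u).card = d := by
  have : (Finset.univ.filter fun x => (E x).1 = u) =
      (Finset.univ : Finset (Fin d)).image fun j => E.symm (u, j) := by
    ext x
    simp only [Finset.mem_filter, Finset.mem_univ, true_and, Finset.mem_image,
      Equiv.symm_apply_eq]
    constructor
    · rintro rfl
      exact ⟨_, rfl⟩
    · rintro ⟨j, hj⟩
      rw [← hj]
  rw [this, Finset.card_image_of_injective _ fun a b h => by simpa using h]
  simp

lemma card_column {n d : ℕ} (E : Fin n ≃ Fin d × Fin d) (u : Fin d) :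
    (Finset.univ.filter fun x => (E x).2 = u).card = d :=
  card_row (E.trans (Equiv.prodComm _ _)) u

lemma card_of_mem_gridRequests {n d f c : ℕ} (E : Fin n ≃ Fin d × Fin d)
    {N : Finset (Fin n)} (hN : N ∈ gridRequests f c E) : N.card = d := by
  rcases List.mem_append.1 hN with h | h
  · obtain ⟨u, rfl⟩ := mem_roundRobin h
    exact card_row E u
  · obtain ⟨u, rfl⟩ := mem_roundRobin h
    exact card_column E u

lemma countP_gridRequests {n d f c : ℕ} (E : Fin n ≃ Fin d × Fin d) (s : Fin n) :
    ((gridRequests f c E).countP fun N => decide (s ∈ N)) = f + c := by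
  rw [gridRequests, List.countP_append, countP_roundRobin f _ _ (E s).1,
    countP_roundRobin c _ _ (E s).2]
  all_goals simp [eq_comm]

lemma length_gridRequests {n d f c : ℕ} (E : Fin n ≃ Fin d × Fin d) :
    (gridRequests f c E).length = f * d + c * d := by
  simp [gridRequests, roundRobin]

/-- The server in row `i` and column `j` is matched in round `i + j`, so that the servers of a
row, and those of a column, use every round once. -/
lemma exists_perfectMatching_gridRequests {d f c : ℕ} (hd : f + c = d)
    (E : Fin (d * d) ≃ Fin d × Fin d) :
    ∃ σ : Fin (d * d) → Fin (gridRequests f c E).length,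
      Function.Bijective σ ∧ ∀ s, s ∈ (gridRequests f c E).get (σ s) := by
  have hlen : (gridRequests f c E).length = d * d := by
    rw [length_gridRequests, ← add_mul, hd]
  let t : Fin (d * d) → Fin d := fun x => (E x).1 + (E x).2
  let u : Fin (d * d) → Fin d := fun x => if (t x).val < f then (E x).1 else (E x).2
  have hlt : ∀ x, (u x).val + d * (t x).val < (gridRequests f c E).length := by
    intro x
    rw [hlen]
    exact (finProdFinEquiv (t x, u x)).isLt
  refine ⟨fun x => ⟨(u x).val + d * (t x).val, hlt x⟩, ?_, ?_⟩
  · rw [Fintype.bijective_iff_injective_and_card]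
    refine ⟨?_, by simp [hlen]⟩
    intro x y hxy
    have h : finProdFinEquiv (t x, u x) = finProdFinEquiv (t y, u y) := by
      ext
      simpa using hxy
    obtain ⟨ht, hu⟩ := Prod.mk.inj (finProdFinEquiv.injective h)
    have : NeZero d := ⟨fun h0 => by subst h0; exact (E x).1.elim0⟩
    apply E.injective
    simp only [u, ht] at hu
    simp only [t] at ht
    split_ifs at hu with hf
    · exact Prod.ext hu (by rw [hu] at ht; exact add_left_cancel ht)
    · exact Prod.ext (by rw [hu] at ht; exact add_right_cancel ht) hu
  · intro x
    have hd0 : 0 < d := (Nat.zero_le _).trans_lt (E x).1.isLt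
    have hu := (u x).isLt
    simp only [gridRequests, List.get_eq_getElem, roundRobin]
    rw [List.getElem_append]
    simp only [List.length_ofFn]
    split_ifs with h
    · have hf : (t x).val < f := by nlinarith
      simp only [List.getElem_ofFn, Finset.mem_filter, Finset.mem_univ, true_and]
      ext
      simp [Fin.modNat, Nat.mod_eq_of_lt hu]
      simp [u, hf]
    · have hf : ¬ (t x).val < f := fun hf => h (by nlinarith)
      obtain ⟨q, hq⟩ := Nat.exists_eq_add_of_le (not_lt.1 hf)
      simp only [List.getElem_ofFn, Finset.mem_filter, Finset.mem_univ, true_and]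
      ext
      have : (u x).val + d * (t x).val - f * d = (u x).val + d * q := by
        rw [hq, mul_add, mul_comm f d]; omega
      simp [Fin.modNat, this, Nat.mod_eq_of_lt hu]
      simp [u, hf]

lemma card_filter_hits_eq {d : ℕ} (S : Fin d → Finset (Fin d)) (I : Finset (Fin d)) {c : ℕ}
    (hS : ∀ i, (S i).card = c) :
    (Finset.univ.filter fun k : Fin d → Fin d =>
      (Finset.univ.filter fun i => k i ∈ S i) = I).card = c ^ I.card * (d - c) ^ (d - I.card) := by
  have : (Finset.univ.filter fun k : Fin d → Fin d =>
      (Finset.univ.filter fun i => k i ∈ S i) = I) =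
      Fintype.piFinset fun i => if i ∈ I then S i else (S i)ᶜ := by
    ext k
    simp only [Finset.mem_filter, Finset.mem_univ, true_and, Fintype.mem_piFinset,
      Finset.ext_iff]
    refine forall_congr' fun i => ?_
    split_ifs with h <;> simp [h]
  rw [this, Fintype.card_piFinset]
  have : ∀ i, (if i ∈ I then S i else (S i)ᶜ).card = if i ∈ I then c else d - c := by
    intro i
    split_ifs <;> simp [hS, Finset.card_compl]
  simp only [this, Finset.prod_ite, Finset.prod_const]
  congr 2
  · simp
  · rw [Finset.filter_not, Finset.card_sdiff_of_subset (by simp)]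
    simp

/-- The total excess over `c` of the number of hits, over all choice functions, is at least that
of a binomial distribution. -/
lemma sum_excess_le {d c : ℕ} (S : Fin d → Finset (Fin d)) (hS : ∀ i, c ≤ (S i).card) :
    ∑ i ∈ Finset.range (d + 1), d.choose i * (c ^ i * (d - c) ^ (d - i) * (i - c)) ≤
      ∑ k : Fin d → Fin d, ((Finset.univ.filter fun i => k i ∈ S i).card - c) := by
  choose S' hsub hcard using fun i => Finset.exists_subset_card_eq (hS i)
  have h := Finset.sum_powerset_apply_card
    (fun i => c ^ i * (d - c) ^ (d - i) * (i - c)) (x := (Finset.univ : Finset (Fin d)))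
  simp only [Finset.card_univ, Fintype.card_fin, smul_eq_mul] at h
  rw [← h]
  calc _ = ∑ k : Fin d → Fin d, ((Finset.univ.filter fun i => k i ∈ S' i).card - c) := by
        rw [← Finset.sum_fiberwise_of_maps_to (s := Finset.univ)
          (t := (Finset.univ : Finset (Fin d)).powerset)
          (g := fun k : Fin d → Fin d => Finset.univ.filter fun i => k i ∈ S' i) (by simp)]
        refine Finset.sum_congr rfl fun I _ => ?_
        rw [← card_filter_hits_eq S' I hcard, ← smul_eq_mul, ← Finset.sum_const]
        refine Finset.sum_congr rfl fun k hk => ?_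
        rw [(Finset.mem_filter.1 hk).2]
    _ ≤ _ := by
        refine Finset.sum_le_sum fun k _ => Nat.sub_le_sub_right (Finset.card_le_card ?_) _
        exact Finset.monotone_filter_right _ fun i _ hi => hsub i hi

lemma shiftedGrid_finProdFinEquiv {d : ℕ} [NeZero d] (k : Fin d → Fin d) (i s : Fin d) :
    shiftedGrid k (finProdFinEquiv (i, s)) = (i, s - k i) := by
  rw [shiftedGrid, Equiv.trans_apply, Equiv.symm_apply_apply]
  rfl

lemma card_column_sdiff {d : ℕ} [NeZero d] (k : Fin d → Fin d) (j : Fin d)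
    (M : Finset (Fin (d * d))) :
    ((Finset.univ.filter fun x => (shiftedGrid k x).2 = j) \ M).card =
      (Finset.univ.filter fun i => finProdFinEquiv (i, j + k i) ∉ M).card := by
  symm
  refine Finset.card_bij (fun i _ => finProdFinEquiv (i, j + k i)) ?_ ?_ ?_
  · intro i hi
    simp only [Finset.mem_filter, Finset.mem_univ, true_and] at hi
    simp [hi, shiftedGrid_finProdFinEquiv]
  · intro a _ b _ h
    exact (Prod.mk.inj (finProdFinEquiv.injective h)).1
  · intro x hx
    obtain ⟨⟨i, s⟩, rfl⟩ := finProdFinEquiv.surjective x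
    simp only [Finset.mem_sdiff, Finset.mem_filter, Finset.mem_univ, true_and,
      shiftedGrid_finProdFinEquiv] at hx
    obtain ⟨rfl, hM⟩ := hx
    exact ⟨i, by simpa using hM, by simp⟩

/-- On average over the shifts, an online algorithm leaves many servers unmatched. -/
lemma sum_card_detRun_le {d f c : ℕ} [NeZero d] (hd : f + c = d)
    (alg : List (Finset (Fin (d * d))) → Option (Fin (d * d))) :
    ∑ k : Fin d → Fin d, (detRun alg [] (gridRequests f c (shiftedGrid k)) ∅).card +
      d * ∑ i ∈ Finset.range (d + 1), d.choose i * (c ^ i * (d - c) ^ (d - i) * (i - c)) ≤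
      d ^ d * (d * d) := by
  set rows : List (Finset (Fin (d * d))) := roundRobin f
    (fun u => Finset.univ.filter fun x => (finProdFinEquiv.symm x).1 = u) with hrows
  set M := detRun alg [] rows ∅ with hM
  have hfree : ∀ i, c ≤ (Finset.univ.filter fun s => finProdFinEquiv (i, s) ∉ M).card := by
    intro i
    have h := card_detRun_inter_fiber_le (m := f) alg (fun x => (finProdFinEquiv.symm x).1) i
      ⟨finProdFinEquiv (i, 0), by simp⟩ [] ∅
    rw [← hrows, ← hM, Finset.empty_inter, Finset.card_empty, zero_add] at h
    have h' : (Finset.univ.filter fun s => finProdFinEquiv (i, s) ∈ M).card ≤ f := by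
      refine le_trans ?_ h
      refine Finset.card_le_card_of_injOn (fun s => finProdFinEquiv (i, s)) ?_ ?_
      · intro s hs
        simp only [Finset.coe_filter, Finset.mem_univ, true_and, Set.mem_ofPred_eq] at hs
        simp [hs, -finProdFinEquiv_symm_apply]
      · intro a _ b _ hab
        exact (Prod.mk.inj (finProdFinEquiv.injective hab)).2
    have h'' := Finset.card_filter_add_card_filter_not (s := (Finset.univ : Finset (Fin d)))
      (fun s => finProdFinEquiv (i, s) ∈ M)
    simp only [Finset.card_univ, Fintype.card_fin] at h''
    omega
  have hcol : ∀ (k : Fin d → Fin d) (j : Fin d),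
      (detRun alg [] (gridRequests f c (shiftedGrid k)) ∅ ∩
        Finset.univ.filter fun x => (shiftedGrid k x).2 = j).card +
      ((Finset.univ.filter fun i => finProdFinEquiv (i, j + k i) ∉ M).card - c) ≤ d := by
    intro k j
    have hrun : detRun alg [] (gridRequests f c (shiftedGrid k)) ∅ =
        detRun alg rows (roundRobin c
          (fun u => Finset.univ.filter fun x => (shiftedGrid k x).2 = u)) M := by
      rw [gridRequests, detRun_append]
      rfl
    have h := card_detRun_inter_fiber_le (m := c) alg (fun x => (shiftedGrid k x).2) j
      ⟨(shiftedGrid k).symm (0, j), by simp⟩ rows M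
    rw [← hrun] at h
    have hle := Finset.card_le_card (Finset.inter_subset_right
      (s₁ := detRun alg [] (gridRequests f c (shiftedGrid k)) ∅)
      (s₂ := Finset.univ.filter fun x => (shiftedGrid k x).2 = j))
    have hsplit := Finset.card_sdiff_add_card_inter
      (Finset.univ.filter fun x => (shiftedGrid k x).2 = j) M
    rw [card_column_sdiff, card_column, Finset.inter_comm] at hsplit
    rw [card_column] at hle
    omega
  have hexcess : ∀ j : Fin d,
      ∑ i ∈ Finset.range (d + 1), d.choose i * (c ^ i * (d - c) ^ (d - i) * (i - c)) ≤
      ∑ k : Fin d → Fin d,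
        ((Finset.univ.filter fun i => finProdFinEquiv (i, j + k i) ∉ M).card - c) := by
    intro j
    refine (sum_excess_le (fun i => Finset.univ.filter fun s => finProdFinEquiv (i, s) ∉ M)
      hfree).trans_eq ?_
    refine (Fintype.sum_equiv (Equiv.addLeft fun _ => j) _ _ fun k => ?_).symm
    simp
  have hcard : ∀ k : Fin d → Fin d,
      (detRun alg [] (gridRequests f c (shiftedGrid k)) ∅).card =
      ∑ j : Fin d, (detRun alg [] (gridRequests f c (shiftedGrid k)) ∅ ∩
        Finset.univ.filter fun x => (shiftedGrid k x).2 = j).card := by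
    intro k
    rw [Finset.card_eq_sum_card_fiberwise (f := fun x => (shiftedGrid k x).2)
      (t := Finset.univ) (by simp)]
    refine Finset.sum_congr rfl fun j _ => ?_
    congr 1
    ext x
    simp
  calc _ ≤ ∑ k : Fin d → Fin d, (detRun alg [] (gridRequests f c (shiftedGrid k)) ∅).card +
        ∑ j : Fin d, ∑ k : Fin d → Fin d,
          ((Finset.univ.filter fun i => finProdFinEquiv (i, j + k i) ∉ M).card - c) := by
        gcongr
        simpa using Finset.card_nsmul_le_sum Finset.univ _ _ fun j _ => hexcess j
    _ = ∑ k : Fin d → Fin d, ∑ j : Fin d,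
        ((detRun alg [] (gridRequests f c (shiftedGrid k)) ∅ ∩
          Finset.univ.filter fun x => (shiftedGrid k x).2 = j).card +
        ((Finset.univ.filter fun i => finProdFinEquiv (i, j + k i) ∉ M).card - c)) := by
        rw [Finset.sum_comm (s := (Finset.univ : Finset (Fin d)))]
        simp only [hcard, Finset.sum_add_distrib]
    _ ≤ ∑ _k : Fin d → Fin d, ∑ _j : Fin d, d :=
        Finset.sum_le_sum fun k _ => Finset.sum_le_sum fun j _ => hcol k j
    _ = d ^ d * (d * d) := by simp

lemma etaBound_mul {d f c : ℕ} (hd : 0 < d) (hf : d / 2 = f) (hc : (d + 1) / 2 = c) :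
    etaBound d * (d ^ d * (d * d)) = d ^ d * (d * d) - d *
      ((∑ i ∈ Finset.range (d + 1),
        d.choose i * (c ^ i * (d - c) ^ (d - i) * (i - c)) : ℕ) : ℝ) := by
  have hfc : f + c = d := by omega
  have hd' : (d : ℝ) ≠ 0 := by positivity
  have hdiff : (1 : ℝ) - (f : ℝ) / d = c / d := by
    rw [eq_div_iff hd', sub_mul, div_mul_cancel₀ _ hd', ← hfc]
    push_cast
    ring
  have hsub : d - c = f := by omega
  rw [etaBound, hf, hc, hdiff, hsub, sub_mul, one_mul, Finset.sum_mul]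
  congr 1
  rw [Nat.cast_sum, Finset.mul_sum]
  have hset : Finset.Icc (c + 1) d ⊆ Finset.range (d + 1) := by
    intro i
    simp only [Finset.mem_Icc, Finset.mem_range]
    omega
  rw [← Finset.sum_subset hset]
  · refine Finset.sum_congr rfl fun i hi => ?_
    obtain ⟨h₁, h₂⟩ := Finset.mem_Icc.1 hi
    have hpow : (d : ℝ) ^ d = d ^ (d - i) * d ^ i := by
      rw [← pow_add, Nat.sub_add_cancel h₂]
    push_cast [Nat.cast_sub (show c ≤ i by omega)]
    rw [div_pow, div_pow, hpow]
    field_simp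
  · intro i hi hi'
    have : i - c = 0 := by
      simp only [Finset.mem_Icc, Finset.mem_range] at hi hi'
      omega
    simp [this]

/-- For every `d ≥ 2` and every randomized online algorithm — modeled as a probability
space `(Ω, μ)` of random seeds together with, for each seed, a deterministic online
algorithm — there is a `d`-regular bipartite instance (servers `Fin ns`, requests arriving
in the order of the list `Ns` of their neighborhoods), which has a perfect matching (so
its maximum matching has size `ns`), on which the expected size of the matching produced
by the algorithm is at most `η(d) · ns`. -/
theorem randomized_hardness_on_regular_graphs (d : ℕ) (hd : 2 ≤ d)
    (Ω : Type*) [MeasurableSpace Ω] (μ : Measure Ω) [IsProbabilityMeasure μ]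
    (alg : Ω → ∀ n : ℕ, List (Finset (Fin n)) → Option (Fin n)) :
    ∃ (ns : ℕ) (Ns : List (Finset (Fin ns))),
      0 < ns ∧
      (∀ N ∈ Ns, N.card = d) ∧
      (∀ s : Fin ns, (Ns.countP fun N => decide (s ∈ N)) = d) ∧
      (∃ σ : Fin ns → Fin Ns.length, Function.Bijective σ ∧ ∀ s, s ∈ Ns.get (σ s)) ∧
      ∫ ω, ((detRun (alg ω ns) [] Ns ∅).card : ℝ) ∂μ ≤ etaBound d * ns := by
  have : NeZero d := ⟨by omega⟩
  obtain ⟨f, hf⟩ : ∃ f, d / 2 = f := ⟨_, rfl⟩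
  obtain ⟨c, hc⟩ : ∃ c, (d + 1) / 2 = c := ⟨_, rfl⟩
  have hfc : f + c = d := by omega
  have hsum : ∀ a : List (Finset (Fin (d * d))) → Option (Fin (d * d)),
      ∑ k : Fin d → Fin d, ((detRun a [] (gridRequests f c (shiftedGrid k)) ∅).card : ℝ) ≤
        etaBound d * (d ^ d * (d * d)) := by
    intro a
    rw [etaBound_mul (by omega) hf hc, le_sub_iff_add_le]
    exact_mod_cast sum_card_detRun_le hfc a
  have hpos : (0 : ℝ) < d ^ d * (d * d) := by positivity
  have heta : 0 ≤ etaBound d :=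
    nonneg_of_mul_nonneg_left
      ((Finset.sum_nonneg fun _ _ => Nat.cast_nonneg _).trans (hsum fun _ => none)) hpos
  suffices h : ∃ k : Fin d → Fin d,
      ∫ ω, ((detRun (alg ω (d * d)) [] (gridRequests f c (shiftedGrid k)) ∅).card : ℝ) ∂μ ≤
        etaBound d * (d * d : ℕ) by
    obtain ⟨k, hk⟩ := h
    refine ⟨d * d, gridRequests f c (shiftedGrid k), by positivity,
      fun N hN => card_of_mem_gridRequests _ hN, fun s => ?_,
      exists_perfectMatching_gridRequests hfc _, hk⟩
    rw [countP_gridRequests, hfc]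
  by_contra! hlt
  have hint : ∀ k : Fin d → Fin d, Integrable (fun ω =>
      ((detRun (alg ω (d * d)) [] (gridRequests f c (shiftedGrid k)) ∅).card : ℝ)) μ := by
    intro k
    by_contra hk
    have := hlt k
    rw [integral_undef hk] at this
    exact this.not_ge (by positivity)
  have hupper : ∑ k : Fin d → Fin d,
      ∫ ω, ((detRun (alg ω (d * d)) [] (gridRequests f c (shiftedGrid k)) ∅).card : ℝ) ∂μ ≤
      etaBound d * (d ^ d * (d * d)) := by
    rw [← integral_finsetSum _ fun k _ => hint k]
    refine (integral_mono (integrable_finsetSum _ fun k _ => hint k) (integrable_const _)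
      fun ω => hsum (alg ω (d * d))).trans_eq ?_
    simp
  have hlower := Finset.sum_lt_sum_of_nonempty
    (Finset.univ_nonempty (α := Fin d → Fin d)) fun k _ => hlt k
  refine (hlower.trans_le hupper).ne ?_
  simp
  ring
end
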